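/- arXiv:1112.3941 — 2 statements merged into one kernel-verified Lean document; each statement's English description precedes it below -/
import Mathlib

section
/- For every integer n > 250, the number of pairs (q, χ), where q > 250 is a prime power and χ is an irreducible complex character of SL₂(F_q) with χ(1) = n, is at most n + 3. -/
/-- A representation is irreducible if the only invariant submodules are `⊥` and `⊤`. -/
def Representation.IsIrred {k H V : Type*} [Field k] [Group H] [AddCommGroup V] [Module k V]
    (ρ : Representation k H V) : Prop :=
  ∀ U : Submodule k V, (∀ h : H, ∀ v ∈ U, ρ h v ∈ U) → U = ⊥ ∨ U = ⊤

section Eigenvectors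

variable {V : Type*} [AddCommGroup V] [Module ℂ V] [FiniteDimensional ℂ V]

theorem Submodule.exists_eigenvector_of_mapsTo (K : Submodule ℂ V) (hK : K ≠ ⊥) (f : V →ₗ[ℂ] V)
    (hf : ∀ v ∈ K, f v ∈ K) : ∃ v ∈ K, v ≠ 0 ∧ ∃ μ : ℂ, f v = μ • v := by
  have : Nontrivial K := Submodule.nontrivial_iff_ne_bot.2 hK
  obtain ⟨μ, hμ⟩ := Module.End.exists_eigenvalue (f.restrict hf)
  obtain ⟨v, hv⟩ := hμ.exists_hasEigenvector
  refine ⟨v, v.2, fun h => hv.2 (Subtype.ext h), μ, ?_⟩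
  simpa using congrArg Subtype.val hv.apply_eq_smul

theorem Submodule.exists_common_eigenvector {ι : Type*} [Finite ι] (f : ι → V →ₗ[ℂ] V)
    (hcomm : ∀ i j, f i ∘ₗ f j = f j ∘ₗ f i) (K : Submodule ℂ V) (hK : K ≠ ⊥)
    (hf : ∀ i, ∀ v ∈ K, f i v ∈ K) : ∃ v ∈ K, v ≠ 0 ∧ ∀ i, ∃ μ : ℂ, f i v = μ • v := by
  classical
  have := Fintype.ofFinite ι
  have key : ∀ s : Finset ι, ∃ L : Submodule ℂ V, L ≤ K ∧ L ≠ ⊥ ∧ (∀ i, ∀ v ∈ L, f i v ∈ L) ∧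
      ∀ i ∈ s, ∃ μ : ℂ, ∀ v ∈ L, f i v = μ • v := by
    intro s
    induction s using Finset.induction_on with
    | empty => exact ⟨K, le_rfl, hK, hf, by simp⟩
    | insert j s _ ih =>
      obtain ⟨L, hLK, hL, hLf, hLs⟩ := ih
      obtain ⟨v, hvL, hv0, μ, hμ⟩ := L.exists_eigenvector_of_mapsTo hL (f j) (hLf j)
      refine ⟨L ⊓ LinearMap.ker (f j - μ • LinearMap.id), inf_le_left.trans hLK, ?_, ?_, ?_⟩
      · intro h
        apply hv0
        have : v ∈ L ⊓ LinearMap.ker (f j - μ • LinearMap.id) := ⟨hvL, by simp [hμ]⟩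
        simpa [h] using this
      · rintro i x ⟨hxL, hx⟩
        refine ⟨hLf i x hxL, ?_⟩
        have hx' : f j x = μ • x := by simpa [sub_eq_zero] using hx
        have h1 : f j (f i x) = f i (f j x) := congrArg (fun g => g x) (hcomm j i)
        simp [h1, hx']
      · intro i hi
        rcases Finset.mem_insert.1 hi with rfl | hi
        · exact ⟨μ, fun x hx => by simpa [sub_eq_zero] using hx.2⟩
        · obtain ⟨ν, hν⟩ := hLs i hi
          exact ⟨ν, fun x hx => hν x hx.1⟩
  obtain ⟨L, hLK, hL, -, hLs⟩ := key Finset.univ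
  obtain ⟨v, hvL, hv0⟩ := (Submodule.ne_bot_iff L).1 hL
  exact ⟨v, hLK hvL, hv0, fun i => (hLs i (Finset.mem_univ i)).imp fun μ h => h v hvL⟩

end Eigenvectors

namespace Representation

variable {G V V' : Type*} [Group G] [AddCommGroup V] [Module ℂ V] [AddCommGroup V'] [Module ℂ V']
  {ρ : Representation ℂ G V} {ρ' : Representation ℂ G V'}

theorem IsIrred.map_mem_of_orbit (h : ρ.IsIrred) {v : V} (hv : v ≠ 0) (P : V →ₗ[ℂ] V)
    (K : Submodule ℂ V) (hP : ∀ g, P (ρ g v) ∈ K) (x : V) : P x ∈ K := by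
  have hU : Submodule.span ℂ (Set.range fun g => ρ g v) = ⊤ := by
    refine (h _ ?_).resolve_left ?_
    · intro g x hx
      have : Submodule.span ℂ (Set.range fun g => ρ g v) ≤
          (Submodule.span ℂ (Set.range fun g => ρ g v)).comap (ρ g) := by
        rw [Submodule.span_le]
        rintro _ ⟨k, rfl⟩
        refine Submodule.subset_span ⟨g * k, ?_⟩
        simp
      exact this hx
    · intro hbot
      have : v ∈ Submodule.span ℂ (Set.range fun g => ρ g v) :=
        Submodule.subset_span ⟨1, by simp⟩
      rw [hbot] at this
      exact hv (by simpa using this)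
  have : Submodule.span ℂ (Set.range fun g => ρ g v) ≤ K.comap P := by
    rw [Submodule.span_le]
    rintro _ ⟨k, rfl⟩
    exact hP k
  exact this (hU ▸ Submodule.mem_top)

/-- Two irreducible representations with vectors having the same matrix coefficients have the same
character. -/
theorem IsIrred.character_eq_of_matrixCoeff (h : ρ.IsIrred) (h' : ρ'.IsIrred) {v : V} {v' : V'}
    (hv : v ≠ 0) (hv' : v' ≠ 0) (P : V →ₗ[ℂ] V) (P' : V' →ₗ[ℂ] V') (hPv : P v = v)
    (hP : ∀ g, ∃ c : ℂ, P (ρ g v) = c • v ∧ P' (ρ' g v') = c • v') :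
    ρ.character = ρ'.character := by
  set W : Submodule ℂ (V × V') := Submodule.span ℂ (Set.range fun g => (ρ g v, ρ' g v')) with hW
  have hinv : ∀ g, ∀ x ∈ W, (ρ g x.1, ρ' g x.2) ∈ W := by
    intro g x hx
    have : W ≤ W.comap ((ρ g).prodMap (ρ' g)) := by
      rw [hW, Submodule.span_le]
      rintro _ ⟨k, rfl⟩
      exact Submodule.subset_span ⟨g * k, by simp⟩
    exact this hx
  have hvW : (v, v') ∈ W := Submodule.subset_span ⟨1, by simp⟩
  have hv0 : (v, (0 : V')) ∉ W := by
    intro hmem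
    have hle : W ≤ (Submodule.span ℂ {(v, v')}).comap (P.prodMap P') := by
      rw [hW, Submodule.span_le]
      rintro _ ⟨k, rfl⟩
      obtain ⟨c, h1, h2⟩ := hP k
      exact Submodule.mem_span_singleton.2 ⟨c, by simp [h1, h2]⟩
    obtain ⟨c, hc⟩ := Submodule.mem_span_singleton.1 (hle hmem)
    simp only [Prod.smul_mk, LinearMap.prodMap_apply, hPv, map_zero, Prod.mk.injEq] at hc
    rcases smul_eq_zero.1 hc.2 with h0 | h0
    · rw [h0, zero_smul] at hc
      exact hv hc.1.symm
    · exact hv' h0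
  have h1 : W.comap (LinearMap.inl ℂ V V') = ⊥ := by
    refine (h _ ?_).resolve_right ?_
    · intro g x hx
      simpa using hinv g _ hx
    · intro ht
      exact hv0 (show v ∈ W.comap (LinearMap.inl ℂ V V') from ht ▸ Submodule.mem_top)
  have h2 : W.comap (LinearMap.inr ℂ V V') = ⊥ := by
    refine (h' _ ?_).resolve_right ?_
    · intro g x hx
      simpa using hinv g _ hx
    · intro ht
      have : v' ∈ W.comap (LinearMap.inr ℂ V V') := ht ▸ Submodule.mem_top
      apply hv0
      simpa using W.sub_mem hvW this
  have h3 : W.map (LinearMap.fst ℂ V V') = ⊤ := by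
    refine (h _ ?_).resolve_left ?_
    · rintro g _ ⟨x, hx, rfl⟩
      exact ⟨_, hinv g x hx, rfl⟩
    · intro hb
      have : v ∈ W.map (LinearMap.fst ℂ V V') := ⟨_, hvW, rfl⟩
      exact hv (by simpa [hb] using this)
  have h4 : W.map (LinearMap.snd ℂ V V') = ⊤ := by
    refine (h' _ ?_).resolve_left ?_
    · rintro g _ ⟨x, hx, rfl⟩
      exact ⟨_, hinv g x hx, rfl⟩
    · intro hb
      have : v' ∈ W.map (LinearMap.snd ℂ V V') := ⟨_, hvW, rfl⟩
      exact hv' (by simpa [hb] using this)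
  let e₁ : W ≃ₗ[ℂ] V := LinearEquiv.ofBijective (LinearMap.fst ℂ V V' ∘ₗ W.subtype) ⟨by
      rw [← LinearMap.ker_eq_bot, LinearMap.ker_eq_bot']
      rintro ⟨⟨x, y⟩, hxy⟩ hx
      obtain rfl : x = 0 := hx
      have : y ∈ W.comap (LinearMap.inr ℂ V V') := hxy
      rw [h2] at this
      simpa using this, by
      intro x
      obtain ⟨y, hy, rfl⟩ : x ∈ W.map (LinearMap.fst ℂ V V') := h3 ▸ Submodule.mem_top
      exact ⟨⟨y, hy⟩, rfl⟩⟩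
  let e₂ : W ≃ₗ[ℂ] V' := LinearEquiv.ofBijective (LinearMap.snd ℂ V V' ∘ₗ W.subtype) ⟨by
      rw [← LinearMap.ker_eq_bot, LinearMap.ker_eq_bot']
      rintro ⟨⟨x, y⟩, hxy⟩ hx
      obtain rfl : y = 0 := hx
      have : x ∈ W.comap (LinearMap.inl ℂ V V') := hxy
      rw [h1] at this
      simpa using this, by
      intro x
      obtain ⟨y, hy, rfl⟩ : x ∈ W.map (LinearMap.snd ℂ V V') := h4 ▸ Submodule.mem_top
      exact ⟨⟨y, hy⟩, rfl⟩⟩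
  have he : ∀ x : W, ∀ g, e₂ (e₁.symm (ρ g (e₁ x))) = ρ' g (e₂ x) := by
    intro x g
    have : e₁.symm (ρ g (e₁ x)) = ⟨_, hinv g x x.2⟩ := by
      rw [LinearEquiv.symm_apply_eq]
      rfl
    rw [this]
    rfl
  funext g
  unfold character
  rw [← LinearMap.trace_conj' (ρ g) (e₁.symm.trans e₂)]
  congr 1
  ext x
  obtain ⟨y, rfl⟩ := e₂.surjective x
  rw [← he y g]
  simp [LinearEquiv.conj_apply]

theorem IsIrred.exists_smul_of_commute [FiniteDimensional ℂ V] (h : ρ.IsIrred) {z : G}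
    (hz : ∀ g, z * g = g * z) : ∃ μ : ℂ, ∀ v, ρ z v = μ • v := by
  by_cases hV : (⊤ : Submodule ℂ V) = ⊥
  · exact ⟨1, fun v => by
      have hv : v ∈ (⊥ : Submodule ℂ V) := hV ▸ Submodule.mem_top
      rw [Submodule.mem_bot] at hv
      simp [hv]⟩
  obtain ⟨v, -, hv, μ, hμ⟩ := Submodule.exists_eigenvector_of_mapsTo ⊤ hV (ρ z) (by simp)
  refine ⟨μ, fun x => ?_⟩
  have hx := h.map_mem_of_orbit hv (ρ z - μ • LinearMap.id) ⊥ (fun g => ?_) x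
  · simpa [sub_eq_zero] using hx
  · have : ρ z (ρ g v) = ρ g (ρ z v) := by
      rw [← Module.End.mul_apply, ← map_mul, hz, map_mul, Module.End.mul_apply]
    simp [this, hμ]

theorem IsIrred.isIrreducible [Nontrivial V] (h : ρ.IsIrred) : ρ.IsIrreducible where
  exists_pair_ne := ⟨⊥, ⊤, fun hbt => by
    have := congrArg Subrepresentation.toSubmodule hbt
    exact bot_ne_top (α := Submodule ℂ V) this⟩
  eq_bot_or_eq_top U := by
    refine (h U.toSubmodule fun g v hv => U.apply_mem_toSubmodule g hv).imp ?_ ?_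
    · intro hU
      exact Subrepresentation.toSubmodule_injective hU
    · intro hU
      exact Subrepresentation.toSubmodule_injective hU

open scoped ComplexOrder MatrixOrder in
theorem character_inv [Finite G] [FiniteDimensional ℂ V] (ρ : Representation ℂ G V) (g : G) :
    ρ.character g⁻¹ = starRingEnd ℂ (ρ.character g) := by
  classical
  have := Fintype.ofFinite G
  let b := Module.finBasis ℂ V
  let A : G → Matrix _ _ ℂ := fun g => LinearMap.toMatrix b b (ρ g)
  have hA : ∀ g k, A (g * k) = A g * A k := fun g k => by
    simp only [A, map_mul, Module.End.mul_eq_comp]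
    exact LinearMap.toMatrix_comp b b b _ _
  have hA1 : A 1 = 1 := by simp [A]
  let H := ∑ g, (A g).conjTranspose * A g
  have hHg : (A g).conjTranspose * H * A g = H := by
    simp only [H, Finset.mul_sum, Finset.sum_mul]
    conv_rhs => rw [← Equiv.sum_comp (Equiv.mulRight g)]
    refine Finset.sum_congr rfl fun k _ => ?_
    simp [hA, Matrix.mul_assoc]
  have hH : H.PosDef := by
    have : H = (A 1).conjTranspose * A 1 + ∑ k ∈ Finset.univ.erase 1, (A k).conjTranspose * A k :=
      (Finset.add_sum_erase _ _ (Finset.mem_univ 1)).symm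
    rw [this, hA1]
    refine Matrix.PosDef.add_posSemidef (by simpa using Matrix.PosDef.one) ?_
    exact Matrix.posSemidef_sum _ fun k _ => Matrix.posSemidef_conjTranspose_mul_self _
  have hdet : IsUnit H.det := hH.det_pos.ne'.isUnit
  have htr : ∀ g, ρ.character g = (A g).trace := fun g => LinearMap.trace_eq_matrix_trace ℂ b (ρ g)
  have hginv : A g * A g⁻¹ = 1 := by rw [← hA, mul_inv_cancel, hA1]
  have h1 : A g⁻¹ = H⁻¹ * ((A g).conjTranspose * H) := by
    calc A g⁻¹ = H⁻¹ * (H * A g⁻¹) := by rw [Matrix.nonsing_inv_mul_cancel_left _ _ hdet]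
      _ = H⁻¹ * (((A g).conjTranspose * H * A g) * A g⁻¹) := by rw [hHg]
      _ = _ := by rw [Matrix.mul_assoc _ (A g), hginv, Matrix.mul_one]
  rw [htr, htr, h1, Matrix.trace_mul_comm, Matrix.mul_assoc, Matrix.mul_nonsing_inv _ hdet,
    Matrix.mul_one, Matrix.trace_conjTranspose]
  rfl

theorem IsIrred.sum_character_mul_conj [Fintype G] [Nontrivial V] [FiniteDimensional ℂ V]
    (h : ρ.IsIrred) :
    ∑ g, ρ.character g * starRingEnd ℂ (ρ.character g) = Fintype.card G := by
  have := h.isIrreducible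
  have hG : (Nat.card G : ℂ) ≠ 0 := by simp
  let : Invertible (Nat.card G : ℂ) := invertibleOfNonzero hG
  have := char_orthonormal ρ ρ
  rw [if_pos ⟨Equiv.refl ρ⟩, inv_mul_eq_iff_eq_mul₀ hG] at this
  simpa [character_inv] using this

theorem IsIrred.sum_character_mul_conj_eq_zero [Fintype G] [Nontrivial V] [Nontrivial V']
    [FiniteDimensional ℂ V] [FiniteDimensional ℂ V'] (h : ρ.IsIrred) (h' : ρ'.IsIrred)
    (hne : ρ.character ≠ ρ'.character) :
    ∑ g, ρ.character g * starRingEnd ℂ (ρ'.character g) = 0 := by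
  have := h.isIrreducible
  have := h'.isIrreducible
  have hG : (Nat.card G : ℂ) ≠ 0 := by simp
  let : Invertible (Nat.card G : ℂ) := invertibleOfNonzero hG
  have := char_orthonormal ρ ρ'
  rw [if_neg (fun ⟨φ⟩ => hne (char_iso φ).symm), inv_mul_eq_iff_eq_mul₀ hG] at this
  simpa [character_inv] using this

end Representation

theorem Fintype.sum_comp_le_sum_of_injective {α β : Type*} [Fintype α] [Fintype β] {e : α → β}
    (he : Function.Injective e) {f : β → ℝ} (hf : ∀ b, 0 ≤ f b) :
    ∑ a, f (e a) ≤ ∑ b, f b := by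
  classical
  rw [← Finset.sum_image (f := f) (fun _ _ _ _ h => he h)]
  exact Finset.sum_le_univ_sum_of_nonneg hf

theorem IsPrimePow.exists_eq_pow_of_dvd {p q : ℕ} (hp : p.Prime) (hq : IsPrimePow q) (h : p ∣ q) :
    ∃ k, q = p ^ k := by
  obtain ⟨r, k, hr, -, rfl⟩ := (isPrimePow_nat_iff q).1 hq
  rw [(Nat.prime_dvd_prime_iff_eq hp hr).1 (hp.dvd_of_dvd_pow h)]
  exact ⟨k, rfl⟩

theorem Nat.two_pow_dvd_two_pow_of_le {m k : ℕ} (h : 2 ^ m ≤ 2 ^ k) : 2 ^ m ∣ 2 ^ k :=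
  pow_dvd_pow 2 ((Nat.pow_le_pow_iff_right one_lt_two).1 h)

theorem not_isPrimePow_pred_and_succ {n : ℕ} (hn : 4 < n) (hodd : n % 2 = 1) :
    ¬(IsPrimePow (n - 1) ∧ IsPrimePow (n + 1)) := by
  rintro ⟨h, h'⟩
  obtain ⟨a, ha⟩ := h.exists_eq_pow_of_dvd Nat.prime_two (by omega)
  obtain ⟨b, hb⟩ := h'.exists_eq_pow_of_dvd Nat.prime_two (by omega)
  have h1 : 2 ^ 2 ∣ n - 1 := ha ▸ Nat.two_pow_dvd_two_pow_of_le (by omega)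
  have h2 : 2 ^ 2 ∣ n + 1 := hb ▸ Nat.two_pow_dvd_two_pow_of_le (by omega)
  omega

theorem three_pow_ne_two_pow_add_one {j k : ℕ} (hk : 16 ≤ 2 ^ k) :
    3 ^ j ≠ 2 ^ k + 1 ∧ 3 ^ j + 1 ≠ 2 ^ k := by
  have h16 : 2 ^ 4 ∣ 2 ^ k := Nat.two_pow_dvd_two_pow_of_le (by omega)
  have h5 : ¬5 ∣ 2 ^ k := fun h => by
    have := Nat.prime_five.dvd_of_dvd_pow h
    omega
  have hj : 3 ^ j = 81 ^ (j / 4) * 3 ^ (j % 4) := by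
    rw [show 81 = 3 ^ 4 from rfl, ← pow_mul, ← pow_add, Nat.div_add_mod]
  have h81 : 81 ^ (j / 4) % 80 = 1 := by
    rw [Nat.pow_mod]
    simp
  have : j % 4 = 0 ∨ j % 4 = 1 ∨ j % 4 = 2 ∨ j % 4 = 3 := by omega
  rcases this with h | h | h | h <;> rw [h] at hj <;> constructor <;> omega

theorem not_isPrimePow_pred_and_self_and_succ {n : ℕ} (hn : 16 ≤ n) (heven : n % 2 = 0) :
    ¬(IsPrimePow (n - 1) ∧ IsPrimePow n ∧ IsPrimePow (n + 1)) := by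
  rintro ⟨h, h', h''⟩
  obtain ⟨k, rfl⟩ := h'.exists_eq_pow_of_dvd Nat.prime_two (by omega)
  have h3 : ¬3 ∣ 2 ^ k := fun h => by
    have := Nat.prime_three.dvd_of_dvd_pow h
    omega
  have : 3 ∣ 2 ^ k - 1 ∨ 3 ∣ 2 ^ k + 1 := by
    have : 2 ^ k % 3 = 1 ∨ 2 ^ k % 3 = 2 := by omega
    omega
  rcases this with h0 | h0
  · obtain ⟨j, hj⟩ := h.exists_eq_pow_of_dvd Nat.prime_three h0
    exact (three_pow_ne_two_pow_add_one (j := j) hn).2 (by omega)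
  · obtain ⟨j, hj⟩ := h''.exists_eq_pow_of_dvd Nat.prime_three h0
    exact (three_pow_ne_two_pow_add_one (j := j) hn).1 hj.symm

theorem Nat.card_le_of_forall_finset_card_le {α : Type*} {b : ℕ} (h : ∀ s : Finset α, s.card ≤ b) :
    Nat.card α ≤ b := by
  rcases finite_or_infinite α with hα | hα
  · have := Fintype.ofFinite α
    rw [Nat.card_eq_fintype_card]
    exact h Finset.univ
  · rw [Nat.card_eq_zero_of_infinite]
    exact zero_le _

namespace SL2

open scoped MatrixGroups ComplexConjugate

section

variable {F : Type*} [Field F]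

/-- The upper unipotent matrix with entry `x`. -/
def u (x : F) : SL(2, F) := ⟨!![1, x; 0, 1], by simp⟩

/-- The diagonal matrix with entries `a` and `a⁻¹`. -/
def t (a : Fˣ) : SL(2, F) := ⟨!![(a : F), 0; 0, (a : F)⁻¹], by simp⟩

/-- The Weyl element. -/
def w : SL(2, F) := ⟨!![0, 1; -1, 0], by simp⟩

theorem coe_u (x : F) : (u x : Matrix (Fin 2) (Fin 2) F) = !![1, x; 0, 1] := rfl

theorem coe_t (a : Fˣ) : (t a : Matrix (Fin 2) (Fin 2) F) = !![(a : F), 0; 0, (a : F)⁻¹] := rfl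

theorem coe_w : ((w : SL(2, F)) : Matrix (Fin 2) (Fin 2) F) = !![0, 1; -1, 0] := rfl

theorem u_zero : u (0 : F) = 1 := by
  ext i j; fin_cases i <;> fin_cases j <;> simp [coe_u]

theorem u_mul (x y : F) : u x * u y = u (x + y) := by
  ext i j; fin_cases i <;> fin_cases j <;> simp [coe_u, add_comm]

theorem t_one : t (1 : Fˣ) = 1 := by
  ext i j; fin_cases i <;> fin_cases j <;> simp [coe_t]

theorem t_mul (a b : Fˣ) : t a * t b = t (a * b) := by
  ext i j; fin_cases i <;> fin_cases j <;> simp [coe_t, mul_comm]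

theorem t_mul_u (a : Fˣ) (x : F) : t a * u x = u ((a : F) ^ 2 * x) * t a := by
  ext i j; fin_cases i <;> fin_cases j <;> simp [coe_t, coe_u]
  field_simp

theorem w_mul_t (a : Fˣ) : w * t a = t a⁻¹ * w := by
  ext i j; fin_cases i <;> fin_cases j <;> simp [coe_t, coe_w]

theorem w_mul_w : w * w = t (-1 : Fˣ) := by
  ext i j; fin_cases i <;> fin_cases j <;> simp [coe_t, coe_w]

theorem t_neg_one_mul (g : SL(2, F)) : t (-1) * g = g * t (-1) := by
  ext i j; fin_cases i <;> fin_cases j <;>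
    simp [coe_t, Matrix.mul_apply, Fin.sum_univ_two, mul_comm]

theorem w_mul_u_mul_w (x : Fˣ) :
    w * u (x : F) * w = u (-(x : F)⁻¹) * (t (-x⁻¹) * w) * u (-(x : F)⁻¹) := by
  ext i j; fin_cases i <;> fin_cases j <;> simp [coe_t, coe_w, coe_u]

theorem tw_mul_u_mul_tw (b c x : Fˣ) :
    t b * w * u (x : F) * (t c * w) =
      u (-((b : F) ^ 2 * (x : F)⁻¹)) * (t (-(b * c * x⁻¹)) * w) *
        u (-((c : F) ^ 2 * (x : F)⁻¹)) := by
  ext i j; fin_cases i <;> fin_cases j <;> simp [coe_t, coe_w, coe_u] <;> field_simp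
  ring

theorem tw_mul_tw (b c : Fˣ) : t b * w * (t c * w) = t (-(b * c⁻¹)) := by
  rw [mul_assoc, ← mul_assoc w, w_mul_t, mul_assoc, w_mul_w, t_mul, t_mul]
  simp

theorem bruhat (g : SL(2, F)) :
    (∃ x a, g = u x * t a) ∨ ∃ x a y, g = u x * (t a * w) * u y := by
  have hd : g 0 0 * g 1 1 - g 0 1 * g 1 0 = 1 := by
    rw [← Matrix.det_fin_two]; exact g.det_coe
  by_cases hc : g 1 0 = 0
  · have h0 : g 1 1 ≠ 0 := fun h => by simp [hc, h] at hd
    have h1 : g 0 0 = (g 1 1)⁻¹ := by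
      rw [hc, mul_zero, sub_zero] at hd
      exact eq_inv_of_mul_eq_one_left hd
    refine Or.inl ⟨g 0 1 * (g 1 1)⁻¹, (Units.mk0 (g 1 1) h0)⁻¹, ?_⟩
    ext i j; fin_cases i <;> fin_cases j <;> simp [coe_t, coe_u, h0, h1, hc]
  · refine Or.inr ⟨g 0 0 * (g 1 0)⁻¹, -(Units.mk0 (g 1 0) hc)⁻¹, g 1 1 * (g 1 0)⁻¹, ?_⟩
    ext i j; fin_cases i <;> fin_cases j <;> simp [coe_t, coe_u, coe_w, hc]
    · field_simp
      linear_combination -hd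
    · field_simp

end

section

variable {F : Type*} [Field F] {V : Type*} [AddCommGroup V] [Module ℂ V]

theorem map_mul_apply {ρ : Representation ℂ SL(2, F) V} (g h : SL(2, F)) (v : V) :
    ρ (g * h) v = ρ g (ρ h v) := by
  simp

variable [Fintype F]

/-- The projection onto the `ψ (a * ·)`-isotypic part for the upper unipotent subgroup. -/
noncomputable def proj (ψ : AddChar F ℂ) (ρ : Representation ℂ SL(2, F) V) (a : F) : V →ₗ[ℂ] V :=
  (Fintype.card F : ℂ)⁻¹ • ∑ x, ψ (-(a * x)) • ρ (u x)

/-- The multiplicity of `ψ (a * ·)` in the restriction to the upper unipotent subgroup. -/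
noncomputable def mult (ψ : AddChar F ℂ) (ρ : Representation ℂ SL(2, F) V) (a : F) : ℕ :=
  Module.finrank ℂ (LinearMap.range (proj ψ ρ a))

variable {ψ : AddChar F ℂ} {ρ : Representation ℂ SL(2, F) V}

theorem proj_apply (a : F) (v : V) :
    proj ψ ρ a v = (Fintype.card F : ℂ)⁻¹ • ∑ x, ψ (-(a * x)) • ρ (u x) v := by
  simp [proj]

theorem proj_u (a y : F) (v : V) : proj ψ ρ a (ρ (u y) v) = ψ (a * y) • proj ψ ρ a v := by
  rw [proj_apply, proj_apply, smul_comm]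
  congr 1
  rw [Finset.smul_sum, ← Equiv.sum_comp (Equiv.subRight y)]
  refine Finset.sum_congr rfl fun x _ => ?_
  rw [Equiv.subRight_apply, ← map_mul_apply, u_mul, sub_add_cancel, smul_smul,
    ← AddChar.map_add_eq_mul]
  congr 2
  ring

theorem u_proj (a y : F) (v : V) : ρ (u y) (proj ψ ρ a v) = ψ (a * y) • proj ψ ρ a v := by
  rw [← proj_u, proj_apply, proj_apply, map_smul, map_sum]
  congr 1
  refine Finset.sum_congr rfl fun x _ => ?_
  rw [map_smul, ← map_mul_apply, ← map_mul_apply, u_mul, u_mul, add_comm]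

theorem t_proj (a : F) (b : Fˣ) (v : V) :
    ρ (t b) (proj ψ ρ a v) = proj ψ ρ (a * ((b⁻¹ : Fˣ) : F) ^ 2) (ρ (t b) v) := by
  rw [proj_apply, proj_apply, map_smul, map_sum]
  congr 1
  rw [← Equiv.sum_comp (Equiv.mulLeft₀ ((b : F) ^ 2) (by simp)) (fun x => ψ _ • ρ (u x) _)]
  refine Finset.sum_congr rfl fun x _ => ?_
  rw [map_smul, ← map_mul_apply, t_mul_u, map_mul_apply]
  have hb : (b : F) ≠ 0 := b.ne_zero
  rw [show Equiv.mulLeft₀ ((b : F) ^ 2) (by simp) x = (b : F) ^ 2 * x from rfl,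
    Units.val_inv_eq_inv_val]
  congr 2
  field_simp

theorem card_ne_zero : (Fintype.card F : ℂ) ≠ 0 := by simp

theorem sum_proj (hψ : ψ.IsPrimitive) (v : V) : ∑ a, proj ψ ρ a v = v := by
  classical
  simp only [proj_apply]
  rw [← Finset.smul_sum, Finset.sum_comm]
  have : ∀ x : F, ∑ a : F, ψ (-(a * x)) • ρ (u x) v =
      if x = 0 then (Fintype.card F : ℂ) • v else 0 := by
    intro x
    rw [← Finset.sum_smul]
    have h := AddChar.sum_mulShift (-x) hψ
    simp only [mul_neg, neg_eq_zero] at h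
    rw [h]
    split_ifs with hx
    · simp [hx, u_zero]
    · simp
  simp only [this]
  rw [Finset.sum_ite_eq' Finset.univ (0 : F), if_pos (Finset.mem_univ _), smul_smul,
    inv_mul_cancel₀ card_ne_zero, one_smul]

theorem proj_proj (hψ : ψ.IsPrimitive) [DecidableEq F] (a b : F) (v : V) :
    proj ψ ρ a (proj ψ ρ b v) = if a = b then proj ψ ρ b v else 0 := by
  rw [proj_apply a]
  simp only [u_proj, smul_smul, ← AddChar.map_add_eq_mul]
  rw [← Finset.sum_smul, smul_smul]
  have h := AddChar.sum_mulShift (b - a) hψ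
  have h2 : ∑ x, ψ (-(a * x) + b * x) = ∑ x, ψ (x * (b - a)) :=
    Finset.sum_congr rfl fun x _ => by congr 1; ring
  rw [h2, h]
  by_cases hab : a = b
  · simp [hab]
  · rw [if_neg hab, if_neg (by rwa [sub_eq_zero, eq_comm])]
    simp

theorem proj_proj_self (hψ : ψ.IsPrimitive) (a : F) (v : V) :
    proj ψ ρ a (proj ψ ρ a v) = proj ψ ρ a v := by
  classical
  rw [proj_proj hψ, if_pos rfl]

theorem proj_proj_of_ne (hψ : ψ.IsPrimitive) {a b : F} (hab : a ≠ b) (v : V) :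
    proj ψ ρ a (proj ψ ρ b v) = 0 := by
  classical
  rw [proj_proj hψ, if_neg hab]

theorem trace_proj [FiniteDimensional ℂ V] (hψ : ψ.IsPrimitive) (a : F) :
    LinearMap.trace ℂ V (proj ψ ρ a) = mult ψ ρ a := by
  have : LinearMap.IsProj (LinearMap.range (proj ψ ρ a)) (proj ψ ρ a) :=
    ⟨fun v => ⟨v, rfl⟩, by rintro _ ⟨v, rfl⟩; exact proj_proj_self hψ a v⟩
  exact this.trace

theorem character_u [FiniteDimensional ℂ V] (hψ : ψ.IsPrimitive) (x : F) :
    ρ.character (u x) = ∑ a, ψ (a * x) * mult ψ ρ a := by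
  have : ρ (u x) = ∑ a, ψ (a * x) • proj ψ ρ a := by
    ext v
    conv_lhs => rw [← sum_proj (ρ := ρ) hψ v]
    simp [u_proj]
  rw [Representation.character, this]
  simp [trace_proj hψ]

theorem finrank_eq_sum_mult [FiniteDimensional ℂ V] (hψ : ψ.IsPrimitive) :
    Module.finrank ℂ V = ∑ a, mult ψ ρ a := by
  have := character_u (ρ := ρ) hψ 0
  rw [u_zero, Representation.char_one] at this
  simp only [mul_zero, AddChar.map_zero_eq_one, one_mul] at this
  exact_mod_cast this

theorem mult_mul_sq [FiniteDimensional ℂ V] (a : F) (b : Fˣ) :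
    mult ψ ρ (a * (b : F) ^ 2) = mult ψ ρ a := by
  have key : ∀ (c : F) (d : Fˣ), mult ψ ρ c ≤ mult ψ ρ (c * ((d⁻¹ : Fˣ) : F) ^ 2) := by
    intro c d
    have hinj : Function.Injective (ρ (t d)) :=
      Function.LeftInverse.injective (g := ρ (t d)⁻¹) fun v => by simp
    rw [mult, (Submodule.equivMapOfInjective _ hinj _).finrank_eq]
    apply Submodule.finrank_mono
    rintro _ ⟨_, ⟨v, rfl⟩, rfl⟩
    exact ⟨_, (t_proj c d v).symm⟩
  refine le_antisymm ?_ ?_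
  · refine (key (a * (b : F) ^ 2) b).trans_eq ?_
    rw [mul_assoc, ← mul_pow]
    simp
  · simpa using key a b⁻¹

end

section

variable {F : Type*} [Field F] {V : Type*} [AddCommGroup V] [Module ℂ V]
variable {ρ : Representation ℂ SL(2, F) V} [Fintype F] {ψ : AddChar F ℂ}

theorem one_le_mult [FiniteDimensional ℂ V] {a : F} {v : V} (h : proj ψ ρ a v ≠ 0) :
    1 ≤ mult ψ ρ a := by
  rw [mult, Submodule.one_le_finrank_iff, Submodule.ne_bot_iff]
  exact ⟨_, ⟨v, rfl⟩, h⟩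

theorem mult_le_one {a : F} {v : V} (h : LinearMap.range (proj ψ ρ a) ≤ ℂ ∙ v) :
    mult ψ ρ a ≤ 1 :=
  (Submodule.finrank_mono h).trans ((finrank_span_le_card _).trans (by simp))

theorem proj_t_proj_of_ne (hψ : ψ.IsPrimitive) {r : F} (hr : r ≠ 0) {b : Fˣ} (hb : b ^ 2 ≠ 1)
    (v : V) : proj ψ ρ r (ρ (t b) (proj ψ ρ r v)) = 0 := by
  rw [t_proj, proj_proj_of_ne hψ]
  intro h
  have h1 : ((b⁻¹ : Fˣ) : F) ^ 2 = 1 := mul_left_cancel₀ hr (by rw [mul_one, ← h])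
  refine hb (inv_injective ?_)
  rw [← inv_pow, inv_one]
  exact Units.ext (by simpa using h1)

theorem proj_tw_proj_tw_proj [DecidableEq F] (r : F) (b c : Fˣ) (v : V) :
    proj ψ ρ r (ρ (t b * w) (proj ψ ρ r (ρ (t c * w) (proj ψ ρ r v)))) =
      (Fintype.card F : ℂ)⁻¹ • (proj ψ ρ r (ρ (t (-(b * c⁻¹))) (proj ψ ρ r v)) +
        ∑ x : Fˣ, ψ (-(r * (x + ((b : F) ^ 2 + (c : F) ^ 2) * (x : F)⁻¹))) •
          proj ψ ρ r (ρ (t (-(b * c * x⁻¹)) * w) (proj ψ ρ r v))) := by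
  rw [proj_apply r (ρ (t c * w) _), map_smul, map_smul, map_sum, map_sum,
    ← Finset.add_sum_erase _ _ (Finset.mem_univ (0 : F))]
  congr 2
  · rw [mul_zero, neg_zero, AddChar.map_zero_eq_one, one_smul, u_zero, map_one,
      Module.End.one_apply, ← map_mul_apply, tw_mul_tw]
  · symm
    refine Finset.sum_bij (fun x _ => (x : F)) (by simp) (fun _ _ _ _ => Units.ext) ?_ ?_
    · intro b hb
      exact ⟨Units.mk0 b (Finset.ne_of_mem_erase hb), Finset.mem_univ _, rfl⟩
    · intro x _
      rw [map_smul, map_smul, ← map_mul_apply, ← map_mul_apply, tw_mul_u_mul_tw,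
        map_mul_apply _ (u (-((c : F) ^ 2 * (x : F)⁻¹))), u_proj, map_smul, map_smul,
        map_mul_apply (u _), proj_u, smul_smul, smul_smul,
        ← AddChar.map_add_eq_mul, ← AddChar.map_add_eq_mul]
      congr 2
      ring

theorem proj_tw_comm (hψ : ψ.IsPrimitive) {r : F} (hr : r ≠ 0) (b c : Fˣ) (v : V) :
    proj ψ ρ r (ρ (t b * w) (proj ψ ρ r (ρ (t c * w) (proj ψ ρ r v)))) =
      proj ψ ρ r (ρ (t c * w) (proj ψ ρ r (ρ (t b * w) (proj ψ ρ r v)))) := by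
  classical
  rw [proj_tw_proj_tw_proj, proj_tw_proj_tw_proj]
  congr 2
  · have hs : -(c * b⁻¹) = (-(b * c⁻¹))⁻¹ := by rw [inv_neg, mul_inv, inv_inv, mul_comm]
    rw [hs]
    by_cases h : (-(b * c⁻¹)) ^ 2 = 1
    · rw [inv_eq_of_mul_eq_one_left (b := -(b * c⁻¹)) (sq (-(b * c⁻¹)) ▸ h)]
    · rw [proj_t_proj_of_ne hψ hr h, proj_t_proj_of_ne hψ hr]
      rwa [inv_pow, Ne, inv_eq_one]
  · simp only [mul_comm b c, add_comm ((b : F) ^ 2)]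

/-- Uniqueness of Whittaker models. -/
theorem mult_le_one_of_ne_zero [FiniteDimensional ℂ V] (hψ : ψ.IsPrimitive) (hρ : ρ.IsIrred)
    {r : F} (hr : r ≠ 0) : mult ψ ρ r ≤ 1 := by
  by_cases h0 : LinearMap.range (proj ψ ρ r) = ⊥
  · rw [mult, h0, finrank_bot]
    exact zero_le_one
  obtain ⟨v, hv, hv0, hμ⟩ := Submodule.exists_common_eigenvector
    (fun b : Fˣ => proj ψ ρ r ∘ₗ ρ (t b * w) ∘ₗ proj ψ ρ r)
    (fun b c => by
      ext v
      simp only [LinearMap.comp_apply, proj_proj_self hψ]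
      exact proj_tw_comm hψ hr b c v)
    (LinearMap.range (proj ψ ρ r)) h0 (fun b v _ => ⟨_, rfl⟩)
  have hPv : proj ψ ρ r v = v := by
    obtain ⟨v, rfl⟩ := hv
    exact proj_proj_self hψ r v
  refine mult_le_one (v := v) ?_
  rintro _ ⟨x, rfl⟩
  refine hρ.map_mem_of_orbit hv0 _ _ (fun g => ?_) x
  obtain ⟨x, b, rfl⟩ | ⟨x, b, y, rfl⟩ := bruhat g
  · rw [map_mul_apply, proj_u]
    refine Submodule.smul_mem _ _ ?_
    by_cases hb : b ^ 2 = 1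
    · obtain ⟨c, hc⟩ := hρ.exists_smul_of_commute (z := t b) (by
        intro g
        have hb' : b = 1 ∨ b = -1 := by
          rw [Units.ext_iff, Units.ext_iff, Units.val_neg, Units.val_one, ← sq_eq_one_iff]
          simpa using congrArg Units.val hb
        rcases hb' with rfl | rfl
        · rw [t_one, one_mul, mul_one]
        · exact t_neg_one_mul g)
      rw [hc, map_smul, hPv]
      exact Submodule.smul_mem _ _ (Submodule.mem_span_singleton_self _)
    · rw [← hPv, proj_t_proj_of_ne hψ hr hb]
      exact Submodule.zero_mem _
  · obtain ⟨c, hc⟩ := hμ b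
    have hu : ρ (u y) v = ψ (r * y) • v := by rw [← hPv, u_proj]
    rw [LinearMap.comp_apply, LinearMap.comp_apply, hPv] at hc
    rw [map_mul_apply, hu, map_smul, map_smul, map_mul_apply, proj_u, hc]
    exact Submodule.smul_mem _ _ (Submodule.smul_mem _ _
      (Submodule.smul_mem _ _ (Submodule.mem_span_singleton_self _)))

end

section

variable {F : Type*} [Field F] {V : Type*} [AddCommGroup V] [Module ℂ V]

/-- `v` is a nonzero vector fixed by the upper unipotent subgroup on which the diagonal torus acts
through `χ`. -/
structure IsWeightVector (ρ : Representation ℂ SL(2, F) V) (χ : Fˣ →* ℂˣ) (v : V) : Prop where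
  ne_zero : v ≠ 0
  u_fixed : ∀ x, ρ (u x) v = v
  t_smul : ∀ a, ρ (t a) v = (χ a : ℂ) • v

variable {ρ : Representation ℂ SL(2, F) V} {χ : Fˣ →* ℂˣ} {v : V}

theorem IsWeightVector.tw (hv : IsWeightVector ρ χ v) (b : Fˣ) :
    ρ (t b * w) v = ((χ b)⁻¹ : ℂ) • ρ w v := by
  have := w_mul_t b⁻¹
  rw [inv_inv] at this
  rw [← this, map_mul_apply, hv.t_smul]
  simp

variable [Fintype F] {ψ : AddChar F ℂ}

theorem proj_zero_of_fixed (hv : ∀ x, ρ (u x) v = v) : proj ψ ρ 0 v = v := by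
  rw [proj_apply]
  simp [hv, ← Nat.cast_smul_eq_nsmul ℂ, smul_smul]

theorem t_proj_zero (b : Fˣ) (v : V) : ρ (t b) (proj ψ ρ 0 v) = proj ψ ρ 0 (ρ (t b) v) := by
  rw [t_proj, zero_mul]

theorem u_proj_zero (x : F) (v : V) : ρ (u x) (proj ψ ρ 0 v) = proj ψ ρ 0 v := by
  rw [u_proj]
  simp

theorem exists_isWeightVector [FiniteDimensional ℂ V] (h : proj ψ ρ 0 ≠ 0) :
    ∃ χ v, IsWeightVector ρ χ v := by
  obtain ⟨_, ⟨v, rfl⟩, hv, hμ⟩ := Submodule.exists_common_eigenvector (fun a : Fˣ => ρ (t a))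
    (fun a b => by
      ext v
      simp only [LinearMap.comp_apply, ← map_mul_apply, t_mul, mul_comm])
    (LinearMap.range (proj ψ ρ 0)) (by rwa [Ne, LinearMap.range_eq_bot]) (by
      rintro a _ ⟨v, rfl⟩
      exact ⟨_, (t_proj_zero a v).symm⟩)
  choose χ hχ using hμ
  have hχ1 : χ 1 = 1 := by
    have := hχ 1
    rw [t_one, map_one, Module.End.one_apply] at this
    refine smul_left_injective ℂ hv ?_
    simp [← this]
  have hχm : ∀ a b, χ (a * b) = χ a * χ b := by
    intro a b
    refine smul_left_injective ℂ hv ?_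
    simp only
    rw [← hχ, ← t_mul, map_mul_apply, hχ, map_smul, hχ, smul_smul, mul_comm]
  exact ⟨MonoidHom.toHomUnits ⟨⟨χ, hχ1⟩, hχm⟩, _, hv, fun x => u_proj_zero x v, hχ⟩

theorem exists_isWeightVector_eigenvector [FiniteDimensional ℂ V] (hv : IsWeightVector ρ χ v)
    (hχ : χ ^ 2 = 1) : ∃ v, IsWeightVector ρ χ v ∧ ∃ c : ℂ, proj ψ ρ 0 (ρ w v) = c • v := by
  have hχ' : ∀ a, ((χ a)⁻¹ : ℂ) = χ a := by
    intro a
    have : χ a ^ 2 = 1 := by rw [← MonoidHom.pow_apply, hχ, MonoidHom.one_apply]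
    rw [← Units.val_inv_eq_inv_val, inv_eq_of_mul_eq_one_left (by rw [← sq, this])]
  let K : Submodule ℂ V :=
    { carrier := {v | (∀ x, ρ (u x) v = v) ∧ ∀ a, ρ (t a) v = (χ a : ℂ) • v}
      zero_mem' := by simp
      add_mem' := by
        intro a b ha hb
        exact ⟨fun x => by rw [map_add, ha.1, hb.1], fun x => by
          rw [map_add, ha.2, hb.2, smul_add]⟩
      smul_mem' := by
        intro c a ha
        exact ⟨fun x => by rw [map_smul, ha.1], fun x => by
          rw [map_smul, ha.2, smul_comm]⟩ }
  obtain ⟨v', hv', h0, c, hc⟩ := Submodule.exists_eigenvector_of_mapsTo K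
    (Submodule.ne_bot_iff K |>.2 ⟨v, ⟨hv.u_fixed, hv.t_smul⟩, hv.ne_zero⟩)
    (proj ψ ρ 0 ∘ₗ ρ w) (by
      intro x hx
      refine ⟨fun y => u_proj_zero _ _, fun a => ?_⟩
      rw [LinearMap.comp_apply, t_proj_zero, ← map_mul_apply,
        show t a * w = w * t a⁻¹ by rw [w_mul_t, inv_inv], map_mul_apply, hx.2, map_smul,
        map_smul, map_inv, Units.val_inv_eq_inv_val, hχ'])
  exact ⟨v', ⟨h0, hv'.1, hv'.2⟩, c, hc⟩

theorem IsWeightVector.proj_u_t (hv : IsWeightVector ρ χ v) (a x : F) (b : Fˣ) :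
    proj ψ ρ a (ρ (u x * t b) v) = (ψ (a * x) * χ b : ℂ) • proj ψ ρ a v := by
  rw [map_mul_apply, proj_u, hv.t_smul, map_smul, smul_smul]

theorem IsWeightVector.proj_u_tw_u (hv : IsWeightVector ρ χ v) (a x y : F) (b : Fˣ) :
    proj ψ ρ a (ρ (u x * (t b * w) * u y) v) =
      (ψ (a * x) * (χ b)⁻¹ : ℂ) • proj ψ ρ a (ρ w v) := by
  rw [map_mul_apply, hv.u_fixed, map_mul_apply, proj_u, hv.tw, map_smul, smul_smul,
    Units.val_inv_eq_inv_val]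

theorem IsWeightVector.proj_zero (hv : IsWeightVector ρ χ v) : proj ψ ρ 0 v = v :=
  proj_zero_of_fixed hv.u_fixed

theorem IsWeightVector.range_proj_zero_le (hρ : ρ.IsIrred) (hv : IsWeightVector ρ χ v) :
    LinearMap.range (proj ψ ρ 0) ≤ Submodule.span ℂ {v, proj ψ ρ 0 (ρ w v)} := by
  rintro _ ⟨x, rfl⟩
  refine hρ.map_mem_of_orbit hv.ne_zero _ _ (fun g => ?_) x
  obtain ⟨x, b, rfl⟩ | ⟨x, b, y, rfl⟩ := bruhat g
  · rw [hv.proj_u_t, hv.proj_zero]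
    exact Submodule.smul_mem _ _ (Submodule.subset_span (by simp))
  · rw [hv.proj_u_tw_u]
    exact Submodule.smul_mem _ _ (Submodule.subset_span (by simp))

/-- The key relation, coming from `w * u x * w = u (-x⁻¹) * t (-x⁻¹) * w * u (-x⁻¹)`. -/
theorem IsWeightVector.proj_w_proj_w [DecidableEq F] (hv : IsWeightVector ρ χ v) (a : F) :
    (Fintype.card F : ℂ) • proj ψ ρ 0 (ρ w (proj ψ ρ a (ρ w v))) =
      (χ (-1) : ℂ) • v +
        (∑ x : Fˣ, ψ (-(a * x)) * χ (-x) : ℂ) • proj ψ ρ 0 (ρ w v) := by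
  rw [proj_apply a, map_smul, map_smul, smul_smul, mul_inv_cancel₀ card_ne_zero, one_smul,
    map_sum, map_sum, ← Finset.add_sum_erase _ _ (Finset.mem_univ (0 : F))]
  congr 1
  · rw [mul_zero, neg_zero, AddChar.map_zero_eq_one, one_smul, u_zero, map_one,
      Module.End.one_apply, ← map_mul_apply, w_mul_w, hv.t_smul, map_smul, hv.proj_zero]
  · rw [Finset.sum_smul]
    symm
    refine Finset.sum_bij (fun x _ => (x : F)) (by simp) (fun _ _ _ _ => Units.ext) ?_ ?_
    · intro b hb
      exact ⟨Units.mk0 b (Finset.ne_of_mem_erase hb), Finset.mem_univ _, rfl⟩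
    · intro x _
      rw [map_smul, map_smul, ← map_mul_apply, ← map_mul_apply, w_mul_u_mul_w, hv.proj_u_tw_u,
        smul_smul, zero_mul, AddChar.map_zero_eq_one, one_mul]
      congr 2
      rw [← map_inv]
      congr 2

end

section

variable {F : Type*} [Field F] {V V' : Type*} [AddCommGroup V] [Module ℂ V]
  [AddCommGroup V'] [Module ℂ V']
variable {ρ : Representation ℂ SL(2, F) V} {ρ' : Representation ℂ SL(2, F) V'} {χ : Fˣ →* ℂˣ}
  {v : V} {v' : V'} [Fintype F] {ψ : AddChar F ℂ}

theorem sum_torus_one [DecidableEq F] (h : χ = 1) :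
    ∑ x : Fˣ, ψ (-((0 : F) * x)) * χ (-x) = (Fintype.card F : ℂ) - 1 := by
  subst h
  simp [Fintype.card_units, Nat.cast_sub Fintype.card_pos]

theorem sum_torus_of_ne_one [DecidableEq F] (h : χ ≠ 1) :
    ∑ x : Fˣ, ψ (-((0 : F) * x)) * χ (-x) = 0 := by
  have : (Units.coeHom ℂ).comp χ ≠ 1 := fun h1 => h <| by
    ext x
    exact DFunLike.congr_fun h1 x
  rw [← sum_hom_units_eq_zero _ this, ← Equiv.sum_comp (Equiv.neg _)]
  simp

theorem IsWeightVector.eigenvalue_eq [DecidableEq F] (hv : IsWeightVector ρ χ v) {c : ℂ}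
    (hc : proj ψ ρ 0 (ρ w v) = c • v) :
    (Fintype.card F : ℂ) * c ^ 2 =
      χ (-1) + (∑ x : Fˣ, ψ (-((0 : F) * x)) * χ (-x) : ℂ) * c := by
  have := hv.proj_w_proj_w (ψ := ψ) 0
  rw [hc, map_smul, map_smul, hc, smul_smul, smul_smul, smul_smul, ← add_smul] at this
  rw [← smul_left_injective ℂ hv.ne_zero this, sq, mul_assoc]

theorem IsWeightVector.proj_zero_w_ne_zero (hv : IsWeightVector ρ χ v) :
    proj ψ ρ 0 (ρ w v) ≠ 0 := by
  classical
  intro h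
  have := hv.proj_w_proj_w (ψ := ψ) 0
  rw [h, map_zero, map_zero, smul_zero, smul_zero, add_zero, eq_comm, smul_eq_zero] at this
  exact this.elim (χ (-1)).ne_zero hv.ne_zero

/-- The opposite weight vector. -/
theorem IsWeightVector.opposite (hv : IsWeightVector ρ χ v) :
    IsWeightVector ρ χ⁻¹ (proj ψ ρ 0 (ρ w v)) where
  ne_zero := hv.proj_zero_w_ne_zero
  u_fixed x := u_proj_zero _ _
  t_smul a := by
    rw [t_proj_zero, ← map_mul_apply, hv.tw, map_smul]
    simp

theorem IsWeightVector.notMem_span (hv : IsWeightVector ρ χ v) (hχ : χ ^ 2 ≠ 1) :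
    v ∉ ℂ ∙ proj ψ ρ 0 (ρ w v) := by
  intro h
  obtain ⟨c, hc⟩ := Submodule.mem_span_singleton.1 h
  refine hχ (MonoidHom.ext fun a => ?_)
  have h1 := hv.t_smul a
  have h2 : ρ (t a) v = ((χ⁻¹ a : ℂˣ) : ℂ) • v := by
    rw [← hc, map_smul, hv.opposite.t_smul, smul_comm]
  rw [h1] at h2
  have h3 := Units.ext (smul_left_injective ℂ hv.ne_zero h2)
  rw [MonoidHom.pow_apply, MonoidHom.one_apply, sq]
  nth_rewrite 2 [h3]
  simp

theorem IsWeightVector.proj_w_ne_zero (hv : IsWeightVector ρ χ v) (hχ : χ ^ 2 ≠ 1) (a : F) :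
    proj ψ ρ a (ρ w v) ≠ 0 := by
  classical
  intro h
  have := hv.proj_w_proj_w (ψ := ψ) a
  rw [h, map_zero, map_zero, smul_zero, eq_comm] at this
  refine hv.notMem_span (ψ := ψ) hχ ?_
  have h1 : (χ (-1) : ℂ) • v ∈ ℂ ∙ proj ψ ρ 0 (ρ w v) := by
    rw [eq_neg_of_add_eq_zero_left this]
    exact Submodule.neg_mem _ (Submodule.smul_mem _ _ (Submodule.mem_span_singleton_self _))
  exact (Submodule.smul_mem_iff _ (χ (-1)).ne_zero).1 h1

theorem IsWeightVector.mult_eq_one [FiniteDimensional ℂ V] (hψ : ψ.IsPrimitive) (hρ : ρ.IsIrred)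
    (hv : IsWeightVector ρ χ v) (hχ : χ ^ 2 ≠ 1) {a : F} (ha : a ≠ 0) : mult ψ ρ a = 1 :=
  le_antisymm (mult_le_one_of_ne_zero hψ hρ ha) (one_le_mult (hv.proj_w_ne_zero hχ a))

theorem IsWeightVector.mult_zero_eq_two [FiniteDimensional ℂ V] (hρ : ρ.IsIrred)
    (hv : IsWeightVector ρ χ v) (hχ : χ ^ 2 ≠ 1) : mult ψ ρ 0 = 2 := by
  have h : LinearMap.range (proj ψ ρ 0) = Submodule.span ℂ {v, proj ψ ρ 0 (ρ w v)} := by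
    refine le_antisymm (hv.range_proj_zero_le hρ) (Submodule.span_le.2 ?_)
    rintro x (rfl | rfl)
    · exact ⟨_, hv.proj_zero⟩
    · exact ⟨_, rfl⟩
  rw [mult, h]
  have hli : LinearIndependent ℂ ![v, proj ψ ρ 0 (ρ w v)] := by
    rw [LinearIndependent.pair_iff' hv.ne_zero]
    intro c hc
    have hc0 : c ≠ 0 := by
      rintro rfl
      rw [zero_smul] at hc
      exact hv.proj_zero_w_ne_zero hc.symm
    refine hv.notMem_span (ψ := ψ) hχ (Submodule.mem_span_singleton.2 ⟨c⁻¹, ?_⟩)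
    rw [← hc, smul_smul, inv_mul_cancel₀ hc0, one_smul]
  have := finrank_span_eq_card hli
  rwa [Matrix.range_cons_cons_empty, Fintype.card_fin] at this

theorem IsWeightVector.finrank_of_sq_ne_one [FiniteDimensional ℂ V] (hψ : ψ.IsPrimitive)
    (hρ : ρ.IsIrred) (hv : IsWeightVector ρ χ v) (hχ : χ ^ 2 ≠ 1) :
    Module.finrank ℂ V = Fintype.card F + 1 := by
  classical
  rw [finrank_eq_sum_mult (ρ := ρ) hψ, ← Finset.add_sum_erase _ _ (Finset.mem_univ (0 : F)),
    hv.mult_zero_eq_two hρ hχ,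
    Finset.sum_congr rfl fun a ha => hv.mult_eq_one hψ hρ hχ (Finset.ne_of_mem_erase ha)]
  have : 0 < Fintype.card F := Fintype.card_pos
  simp [Finset.card_erase_of_mem]
  omega

theorem IsWeightVector.character_eq (hρ : ρ.IsIrred) (hρ' : ρ'.IsIrred)
    (hv : IsWeightVector ρ χ v) (hv' : IsWeightVector ρ' χ v') (hχ : χ ^ 2 ≠ 1)
    (ψ : AddChar F ℂ) : ρ.character = ρ'.character := by
  obtain ⟨f, hf, hfy⟩ : ∃ f : Module.Dual ℂ V, f v = 1 ∧ f (proj ψ ρ 0 (ρ w v)) = 0 := by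
    obtain ⟨f, hf, hK⟩ := Submodule.exists_le_ker_of_notMem (hv.notMem_span (ψ := ψ) hχ)
    refine ⟨(f v)⁻¹ • f, by simp [hf], ?_⟩
    have : f (proj ψ ρ 0 (ρ w v)) = 0 := hK (Submodule.mem_span_singleton_self _)
    simp [this]
  obtain ⟨f', hf', hfy'⟩ : ∃ f : Module.Dual ℂ V', f v' = 1 ∧ f (proj ψ ρ' 0 (ρ' w v')) = 0 := by
    obtain ⟨f, hf, hK⟩ := Submodule.exists_le_ker_of_notMem (hv'.notMem_span (ψ := ψ) hχ)
    refine ⟨(f v')⁻¹ • f, by simp [hf], ?_⟩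
    have : f (proj ψ ρ' 0 (ρ' w v')) = 0 := hK (Submodule.mem_span_singleton_self _)
    simp [this]
  refine hρ.character_eq_of_matrixCoeff hρ' hv.ne_zero hv'.ne_zero
    ((f ∘ₗ proj ψ ρ 0).smulRight v) ((f' ∘ₗ proj ψ ρ' 0).smulRight v') ?_ fun g => ?_
  · simp [hv.proj_zero, hf]
  · obtain ⟨x, b, rfl⟩ | ⟨x, b, y, rfl⟩ := bruhat g
    · refine ⟨χ b, ?_, ?_⟩
      · rw [LinearMap.smulRight_apply, LinearMap.comp_apply, hv.proj_u_t, hv.proj_zero]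
        simp [hf]
      · rw [LinearMap.smulRight_apply, LinearMap.comp_apply, hv'.proj_u_t, hv'.proj_zero]
        simp [hf']
    · refine ⟨0, ?_, ?_⟩
      · rw [LinearMap.smulRight_apply, LinearMap.comp_apply, hv.proj_u_tw_u, map_smul, hfy]
        simp
      · rw [LinearMap.smulRight_apply, LinearMap.comp_apply, hv'.proj_u_tw_u, map_smul, hfy']
        simp

theorem IsWeightVector.character_eq_of_eigenvalue (hρ : ρ.IsIrred) (hρ' : ρ'.IsIrred)
    (hv : IsWeightVector ρ χ v) (hv' : IsWeightVector ρ' χ v') {c : ℂ}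
    (hc : proj ψ ρ 0 (ρ w v) = c • v) (hc' : proj ψ ρ' 0 (ρ' w v') = c • v') :
    ρ.character = ρ'.character := by
  refine hρ.character_eq_of_matrixCoeff hρ' hv.ne_zero hv'.ne_zero (proj ψ ρ 0) (proj ψ ρ' 0)
    hv.proj_zero fun g => ?_
  obtain ⟨x, b, rfl⟩ | ⟨x, b, y, rfl⟩ := bruhat g
  · exact ⟨_, by rw [hv.proj_u_t, hv.proj_zero], by rw [hv'.proj_u_t, hv'.proj_zero]⟩
  · exact ⟨_, by rw [hv.proj_u_tw_u, hc, smul_smul], by rw [hv'.proj_u_tw_u, hc', smul_smul]⟩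

theorem IsWeightVector.mult_zero_eq_one [FiniteDimensional ℂ V] (hρ : ρ.IsIrred)
    (hv : IsWeightVector ρ χ v) {c : ℂ} (hc : proj ψ ρ 0 (ρ w v) = c • v) :
    mult ψ ρ 0 = 1 := by
  refine le_antisymm (mult_le_one (v := v) ((hv.range_proj_zero_le hρ).trans
    (Submodule.span_le.2 ?_))) (one_le_mult (v := v) (by rw [hv.proj_zero]; exact hv.ne_zero))
  rintro x (rfl | rfl)
  · exact Submodule.mem_span_singleton_self _
  · rw [hc]
    exact Submodule.smul_mem _ _ (Submodule.mem_span_singleton_self _)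

theorem IsWeightVector.finrank_eq_one_of_eigenvalue_one [FiniteDimensional ℂ V] (hρ : ρ.IsIrred)
    (hv : IsWeightVector ρ 1 v) (hc : proj ψ ρ 0 (ρ w v) = (1 : ℂ) • v) :
    Module.finrank ℂ V = 1 := by
  have h1 : IsWeightVector (Representation.trivial ℂ SL(2, F) ℂ) 1 (1 : ℂ) :=
    ⟨one_ne_zero, by simp, by simp⟩
  have hirr : (Representation.trivial ℂ SL(2, F) ℂ).IsIrred := fun U _ => eq_bot_or_eq_top U
  have := congrFun (hv.character_eq_of_eigenvalue hρ hirr h1 hc (by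
    rw [Representation.isTrivial_apply, h1.proj_zero, one_smul])) 1
  rw [Representation.char_one, Representation.char_one] at this
  simpa using this

end

section

section SquareInvariant

variable {F : Type*} [Field F]

theorem eq_of_mul_sq_invariant {f : F → ℕ} (hf : ∀ (a : F) (b : Fˣ), f (a * (b : F) ^ 2) = f a)
    {a b : F} (ha : a ≠ 0) (hb : b ≠ 0) (h : IsSquare (a * b)) : f a = f b := by
  obtain ⟨c, hc⟩ := h
  have hc0 : c ≠ 0 := by
    rintro rfl
    simp [ha, hb] at hc
  have := hf b (Units.mk0 (c / b) (div_ne_zero hc0 hb))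
  rw [← this]
  congr 1
  simp only [Units.val_mk0]
  field_simp
  rw [hc, sq]

variable [Fintype F]

theorem isSquare_mul_of_not_isSquare {a b : F} (ha : ¬IsSquare a) (hb : ¬IsSquare b) :
    IsSquare (a * b) := by
  classical
  have hF : ringChar F ≠ 2 := fun h => ha (FiniteField.isSquare_of_char_two h a)
  have ha0 : a ≠ 0 := by rintro rfl; exact ha (IsSquare.zero)
  have hb0 : b ≠ 0 := by rintro rfl; exact hb (IsSquare.zero)
  rw [← quadraticChar_one_iff_isSquare (mul_ne_zero ha0 hb0), map_mul,
    quadraticChar_neg_one_iff_not_isSquare.2 ha, quadraticChar_neg_one_iff_not_isSquare.2 hb]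
  norm_num

/-- A `{0, 1}`-valued function on `Fˣ` invariant under multiplication by squares is constant or
the indicator function of the squares or of the non-squares. -/
theorem mul_sq_invariant_cases [DecidableEq F] {f : F → ℕ}
    (hf : ∀ (a : F) (b : Fˣ), f (a * (b : F) ^ 2) = f a) (hf1 : ∀ a ≠ 0, f a ≤ 1) :
    (∀ a ≠ 0, f a = 0) ∨ (∀ a ≠ 0, f a = 1) ∨
      (2 * ∑ a ∈ Finset.univ.erase 0, f a + 1 = Fintype.card F ∧
        ∀ a ≠ 0, f a = if IsSquare a then f 1 else 1 - f 1) := by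
  have hs : ∀ a ≠ 0, IsSquare a → f a = f 1 := fun a ha h =>
    eq_of_mul_sq_invariant hf ha one_ne_zero (by simpa using h)
  have h01 : f 1 = 0 ∨ f 1 = 1 := by have := hf1 1 one_ne_zero; omega
  have hconst : (∀ a ≠ 0, f a = f 1) → (∀ a ≠ 0, f a = 0) ∨ (∀ a ≠ 0, f a = 1) := fun h =>
    h01.imp (fun h0 a ha => (h a ha).trans h0) (fun h0 a ha => (h a ha).trans h0)
  by_cases hd : ∃ d : F, ¬IsSquare d ∧ f d ≠ f 1
  · obtain ⟨d, hd, hfd⟩ := hd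
    have hd0 : d ≠ 0 := by rintro rfl; exact hd (IsSquare.zero)
    have hF : ringChar F ≠ 2 := fun h => hd (FiniteField.isSquare_of_char_two h d)
    have hval : ∀ a ≠ 0, f a = if IsSquare a then f 1 else 1 - f 1 := by
      intro a ha
      split_ifs with h
      · exact hs a ha h
      · rw [eq_of_mul_sq_invariant hf ha hd0 (isSquare_mul_of_not_isSquare h hd)]
        have := hf1 d hd0
        omega
    refine Or.inr (Or.inr ⟨?_, hval⟩)
    have h2 : ∀ a ∈ Finset.univ.erase (0 : F),
        (2 * f a : ℤ) = 1 + (2 * f 1 - 1) * quadraticChar F a := by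
      intro a ha
      have ha := Finset.ne_of_mem_erase ha
      rw [hval a ha]
      split_ifs with h
      · rw [(quadraticChar_one_iff_isSquare ha).2 h]
        ring
      · rw [quadraticChar_neg_one_iff_not_isSquare.2 h]
        rcases h01 with h | h <;> simp [h]
    have h3 : ∑ a ∈ Finset.univ.erase (0 : F), quadraticChar F a = 0 := by
      rw [← quadraticChar_sum_zero hF, ← Finset.add_sum_erase _ _ (Finset.mem_univ (0 : F))]
      simp
    have h4 := Finset.sum_congr rfl h2
    rw [← Finset.mul_sum, Finset.sum_add_distrib, ← Finset.mul_sum, h3, Finset.sum_const,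
      Finset.card_erase_of_mem (Finset.mem_univ _), Finset.card_univ] at h4
    have : 0 < Fintype.card F := Fintype.card_pos
    push_cast [Nat.cast_sub (Nat.succ_le_of_lt this), nsmul_eq_mul] at h4
    zify
    linarith
  · push Not at hd
    refine (hconst fun a ha => ?_).imp_right Or.inl
    by_cases h : IsSquare a
    · exact hs a ha h
    · exact hd a h

end SquareInvariant

variable {F : Type*} [Field F] {V V' : Type*} [AddCommGroup V] [Module ℂ V]
  [AddCommGroup V'] [Module ℂ V']
variable {ρ : Representation ℂ SL(2, F) V} {χ : Fˣ →* ℂˣ}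
  {v : V} [Fintype F] {ψ : AddChar F ℂ}

theorem finrank_cases [DecidableEq F] [FiniteDimensional ℂ V] (hψ : ψ.IsPrimitive)
    (hρ : ρ.IsIrred) :
    Module.finrank ℂ V = mult ψ ρ 0 ∨
      ((∀ a ≠ 0, mult ψ ρ a = 1) ∧
        Module.finrank ℂ V + 1 = mult ψ ρ 0 + Fintype.card F) ∨
      ((∀ a ≠ 0, mult ψ ρ a = if IsSquare a then mult ψ ρ 1 else 1 - mult ψ ρ 1) ∧
        2 * Module.finrank ℂ V + 1 = 2 * mult ψ ρ 0 + Fintype.card F) := by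
  have hn := finrank_eq_sum_mult (ρ := ρ) hψ
  rw [← Finset.add_sum_erase _ _ (Finset.mem_univ (0 : F))] at hn
  have : 0 < Fintype.card F := Fintype.card_pos
  rcases mul_sq_invariant_cases mult_mul_sq
    fun a ha => mult_le_one_of_ne_zero (ψ := ψ) hψ hρ ha with h | h | ⟨h, h'⟩
  · left
    rw [hn, Finset.sum_eq_zero fun a ha => h a (Finset.ne_of_mem_erase ha), add_zero]
  · right; left
    refine ⟨h, ?_⟩
    rw [hn, Finset.sum_congr rfl fun a ha => h a (Finset.ne_of_mem_erase ha), Finset.sum_const,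
      Finset.card_erase_of_mem (Finset.mem_univ _), Finset.card_univ, smul_eq_mul, mul_one]
    omega
  · right; right
    exact ⟨h', by omega⟩

theorem IsWeightVector.finrank_of_eigenvalue [FiniteDimensional ℂ V] (hψ : ψ.IsPrimitive)
    (hρ : ρ.IsIrred) (hv : IsWeightVector ρ χ v) {c : ℂ} (hc : proj ψ ρ 0 (ρ w v) = c • v) :
    Module.finrank ℂ V = 1 ∨ Module.finrank ℂ V = Fintype.card F ∨
      2 * Module.finrank ℂ V = Fintype.card F + 1 := by
  classical
  have := finrank_cases hψ hρ
  rw [hv.mult_zero_eq_one hρ hc] at this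
  omega

end

section

variable {F : Type*} [Field F] [Fintype F] {ψ : AddChar F ℂ}

section

variable {V : Type*} [AddCommGroup V] [Module ℂ V] [FiniteDimensional ℂ V]
  {ρ : Representation ℂ SL(2, F) V}

theorem irreducible_cases [DecidableEq F] (hψ : ψ.IsPrimitive) (hρ : ρ.IsIrred)
    (h1 : 1 < Module.finrank ℂ V) :
    (∃ χ v, IsWeightVector ρ χ v ∧ χ ^ 2 ≠ 1 ∧ Module.finrank ℂ V = Fintype.card F + 1) ∨
    (∃ χ v, IsWeightVector ρ χ v ∧ χ ^ 2 = 1 ∧ (∃ c : ℂ, proj ψ ρ 0 (ρ w v) = c • v) ∧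
      (Module.finrank ℂ V = Fintype.card F ∨ 2 * Module.finrank ℂ V = Fintype.card F + 1)) ∨
    (mult ψ ρ 0 = 0 ∧ (∀ a ≠ 0, mult ψ ρ a = 1) ∧ Module.finrank ℂ V + 1 = Fintype.card F) ∨
    (mult ψ ρ 0 = 0 ∧
      (∀ a ≠ 0, mult ψ ρ a = if IsSquare a then mult ψ ρ 1 else 1 - mult ψ ρ 1) ∧
      2 * Module.finrank ℂ V + 1 = Fintype.card F) := by
  by_cases h0 : proj ψ ρ 0 = 0
  · have hm : mult ψ ρ 0 = 0 := by rw [mult, h0, LinearMap.range_zero, finrank_bot]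
    have := finrank_cases hψ hρ
    rw [hm] at this ⊢
    rcases this with h | ⟨h, h'⟩ | ⟨h, h'⟩
    · omega
    · exact Or.inr (Or.inr (Or.inl ⟨rfl, h, by omega⟩))
    · exact Or.inr (Or.inr (Or.inr ⟨rfl, h, by omega⟩))
  · obtain ⟨χ, v, hv⟩ := exists_isWeightVector h0
    by_cases hχ : χ ^ 2 = 1
    · obtain ⟨v, hv, c, hc⟩ := exists_isWeightVector_eigenvector (ψ := ψ) hv hχ
      refine Or.inr (Or.inl ⟨χ, v, hv, hχ, ⟨c, hc⟩, ?_⟩)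
      exact (hv.finrank_of_eigenvalue hψ hρ hc).resolve_left h1.ne'
    · exact Or.inl ⟨χ, v, hv, hχ, hv.finrank_of_sq_ne_one hψ hρ hχ⟩

end

/-- The set of irreducible characters of degree `n` of `SL(2, F)`. -/
def irrChars (F : Type*) [Field F] (n : ℕ) : Set (SL(2, F) → ℂ) :=
  {χ | ∃ ρ : Representation ℂ SL(2, F) (Fin n → ℂ), ρ.IsIrred ∧ χ = ρ.character}

theorem exists_isPrimitive (F : Type*) [Field F] [Fintype F] :
    ∃ ψ : AddChar F ℂ, ψ.IsPrimitive :=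
  ⟨_, AddChar.FiniteField.primitiveChar_to_Complex_isPrimitive F⟩

theorem two_mul_card_le_of_subset_irrChars_add_one (hq : 2 < Fintype.card F)
    {s : Finset (SL(2, F) → ℂ)} (hs : ↑s ⊆ irrChars F (Fintype.card F + 1)) :
    2 * s.card + 2 ≤ Fintype.card F := by
  classical
  obtain ⟨ψ, hψ⟩ := exists_isPrimitive F
  have : Fintype (Fˣ →* ℂˣ) := Fintype.ofFinite _
  have hcard : Fintype.card (Fˣ →* ℂˣ) = Fintype.card F - 1 := by
    have : NeZero (Monoid.exponent Fˣ) := ⟨Monoid.exponent_ne_zero_of_finite⟩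
    rw [← Nat.card_eq_fintype_card, CommGroup.card_monoidHom_of_hasEnoughRootsOfUnity,
      Nat.card_eq_fintype_card, Fintype.card_units]
  have key := Finset.card_mul_le_card_mul (s := s) (t := Finset.univ.filter fun χ => χ ^ 2 ≠ 1)
    (m := 2) (n := 1)
    (fun (f : SL(2, F) → ℂ) (χ : Fˣ →* ℂˣ) =>
      ∃ ρ : Representation ℂ SL(2, F) (Fin (Fintype.card F + 1) → ℂ), ρ.IsIrred ∧
        f = ρ.character ∧ ∃ v, IsWeightVector ρ χ v)
    (by
      intro f hf
      obtain ⟨ρ, hρ, rfl⟩ := hs hf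
      have := irreducible_cases hψ hρ (by simp; omega)
      rw [Module.finrank_fin_fun] at this
      obtain ⟨χ, v, hv, hχ, -⟩ := this.resolve_right (by
        rintro (⟨-, -, -, -, -, h⟩ | ⟨-, -, h⟩ | ⟨-, -, h⟩) <;> omega)
      have hne : χ ≠ χ⁻¹ := fun h => hχ (by
        rw [sq]
        nth_rewrite 1 [h]
        exact inv_mul_cancel χ)
      refine (Finset.card_pair hne).ge.trans (Finset.card_le_card fun χ' hχ' => ?_)
      rw [Finset.mem_bipartiteAbove, Finset.mem_filter]
      rcases Finset.mem_insert.1 hχ' with rfl | hχ'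
      · exact ⟨⟨Finset.mem_univ _, hχ⟩, ρ, hρ, rfl, v, hv⟩
      · rw [Finset.mem_singleton.1 hχ']
        exact ⟨⟨Finset.mem_univ _, fun h => hχ (inv_eq_one.1 ((inv_pow χ 2).symm.trans h))⟩,
          ρ, hρ, rfl, _, hv.opposite (ψ := ψ)⟩)
    (by
      intro χ hχ
      rw [Finset.card_le_one]
      intro f hf f' hf'
      obtain ⟨-, ρ, hρ, rfl, v, hv⟩ := (Finset.mem_bipartiteBelow _).1 hf
      obtain ⟨-, ρ', hρ', rfl, v', hv'⟩ := (Finset.mem_bipartiteBelow _).1 hf'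
      exact hv.character_eq hρ hρ' hv' (Finset.mem_filter.1 hχ).2 ψ)
  have h2 : (Finset.univ.filter fun χ : Fˣ →* ℂˣ => χ ^ 2 ≠ 1).card < Fintype.card (Fˣ →* ℂˣ) :=
    Finset.card_lt_univ_of_notMem (x := 1)
      fun h => (Finset.mem_filter.1 h).2 (MonoidHom.ext fun x => by
        rw [MonoidHom.pow_apply, MonoidHom.one_apply, one_pow])
  omega

theorem card_le_three_of_subset_irrChars {n : ℕ} (hq : 3 < Fintype.card F)
    (hn : n = Fintype.card F ∨ 2 * n = Fintype.card F + 1)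
    {s : Finset (SL(2, F) → ℂ)} (hs : ↑s ⊆ irrChars F n) : s.card ≤ 3 := by
  classical
  obtain ⟨ψ, hψ⟩ := exists_isPrimitive F
  obtain ⟨g, hg⟩ := IsCyclic.exists_generator (α := Fˣ)
  have hext : ∀ χ χ' : Fˣ →* ℂˣ, (χ g : ℂ) = χ' g → χ = χ' := by
    intro χ χ' h
    ext x
    obtain ⟨k, rfl⟩ := Subgroup.mem_zpowers_iff.1 (hg x)
    rw [map_zpow, map_zpow, Units.ext h]
  obtain ⟨m, hm⟩ := Subgroup.mem_zpowers_iff.1 (hg (-1))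
  obtain ⟨r, hr⟩ := IsAlgClosed.exists_pow_nat_eq ((-1 : ℂ) ^ m / Fintype.card F) two_pos
  refine (Finset.card_le_card_of_forall_subsingleton (t := {((1 : ℂ), -(Fintype.card F : ℂ)⁻¹),
    (-1, r), (-1, -r)})
    (fun (f : SL(2, F) → ℂ) (p : ℂ × ℂ) =>
      ∃ ρ : Representation ℂ SL(2, F) (Fin n → ℂ), ρ.IsIrred ∧ f = ρ.character ∧
        ∃ (χ : Fˣ →* ℂˣ) (v : _), IsWeightVector ρ χ v ∧ (χ g : ℂ) = p.1 ∧
          proj ψ ρ 0 (ρ w v) = p.2 • v) ?_ ?_).trans Finset.card_le_three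
  · intro f hf
    obtain ⟨ρ, hρ, rfl⟩ := hs hf
    have hn1 : 1 < Module.finrank ℂ (Fin n → ℂ) := by rw [Module.finrank_fin_fun]; omega
    have := irreducible_cases hψ hρ hn1
    rw [Module.finrank_fin_fun] at this hn1
    obtain ⟨χ, v, hv, hχ, ⟨c, hc⟩, -⟩ : ∃ χ v, IsWeightVector ρ χ v ∧ χ ^ 2 = 1 ∧
        (∃ c : ℂ, proj ψ ρ 0 (ρ w v) = c • v) ∧ _ := by
      refine (this.resolve_left ?_).resolve_right ?_
      · rintro ⟨-, -, -, -, h⟩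
        omega
      · rintro (⟨-, -, h⟩ | ⟨-, -, h⟩) <;> omega
    have hq0 : (Fintype.card F : ℂ) ≠ 0 := card_ne_zero
    have hceq := hv.eigenvalue_eq hc
    refine ⟨(χ g, c), ?_, ρ, hρ, rfl, χ, v, hv, rfl, hc⟩
    by_cases h1 : χ = 1
    · subst h1
      rw [sum_torus_one rfl, MonoidHom.one_apply, Units.val_one] at hceq
      have hc1 : c - 1 ≠ 0 := by
        intro h
        rw [sub_eq_zero.1 h] at hc
        have := hv.finrank_eq_one_of_eigenvalue_one hρ hc
        rw [Module.finrank_fin_fun] at this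
        omega
      have hc2 : (c - 1) * (Fintype.card F * c + 1) = 0 := by linear_combination hceq
      have hc3 : c = -(Fintype.card F : ℂ)⁻¹ := by
        have := (mul_eq_zero.1 hc2).resolve_left hc1
        field_simp
        linear_combination this
      simp [hc3]
    · have hg1 : (χ g : ℂ) = -1 := by
        have h2 : (χ g : ℂ) ^ 2 = 1 := by
          rw [← Units.val_pow_eq_pow_val, ← MonoidHom.pow_apply, hχ, MonoidHom.one_apply,
            Units.val_one]
        refine (sq_eq_one_iff.1 h2).resolve_left ?_
        intro h
        exact h1 (hext _ _ (by rw [h, MonoidHom.one_apply, Units.val_one]))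
      have hm1 : (χ (-1) : ℂ) = (-1) ^ m := by
        rw [← hm, map_zpow, Units.val_zpow_eq_zpow_val, hg1]
      rw [sum_torus_of_ne_one h1, zero_mul, add_zero, hm1] at hceq
      have : c ^ 2 = r ^ 2 := by
        rw [hr, ← hceq]
        field_simp
      rcases sq_eq_sq_iff_eq_or_eq_neg.1 this with h | h <;> simp [h, hg1]
  · rintro ⟨l, c⟩ - f ⟨-, ρ, hρ, rfl, χ, v, hv, hl, hc⟩ f' ⟨-, ρ', hρ', rfl, χ', v', hv', hl', hc'⟩
    obtain rfl := hext χ χ' (hl.trans hl'.symm)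
    exact hv.character_eq_of_eigenvalue hρ hρ' hv' hc hc'

end

section

variable {F : Type*} [Field F]

/-- Representatives for the cosets of the upper triangular subgroup. -/
def coset : Option F → SL(2, F)
  | none => 1
  | some y => u y * w

/-- A parametrization of the unipotent elements. -/
def unipotent : Option (Option F × Fˣ) → SL(2, F)
  | none => 1
  | some (o, x) => coset o * u (x : F) * (coset o)⁻¹

theorem coe_unipotent_none (x : Fˣ) :
    (unipotent (some (none, x)) : Matrix (Fin 2) (Fin 2) F) = !![1, (x : F); 0, 1] := by
  simp [unipotent, coset, coe_u]

theorem coe_unipotent_some (y : F) (x : Fˣ) :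
    (unipotent (some (some y, x)) : Matrix (Fin 2) (Fin 2) F) =
      !![1 - x * y, x * y ^ 2; -x, 1 + x * y] := by
  simp only [unipotent, coset, Matrix.SpecialLinearGroup.coe_mul, Matrix.SpecialLinearGroup.coe_inv,
    coe_u, coe_w, Matrix.adjugate_fin_two]
  ext i j; fin_cases i <;> fin_cases j <;> simp <;> ring

theorem unipotent_injective : Function.Injective (unipotent (F := F)) := by
  intro i j hij
  have h00 := congrArg (fun g : SL(2, F) => g 0 0) hij
  have h01 := congrArg (fun g : SL(2, F) => g 0 1) hij
  have h10 := congrArg (fun g : SL(2, F) => g 1 0) hij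
  have h0 : unipotent (F := F) none = 1 := rfl
  rcases i with _ | ⟨_ | y, x⟩ <;> rcases j with _ | ⟨_ | y', x'⟩ <;>
    simp [coe_unipotent_none, coe_unipotent_some, h0] at h00 h01 h10
  · rfl
  · exact absurd h01.symm x'.ne_zero
  · rw [Units.ext h01]
  · obtain rfl := Units.ext h10
    simpa using h00

theorem trace_unipotent (i : Option (Option F × Fˣ)) :
    unipotent i 0 0 + unipotent i 1 1 = 2 := by
  have h0 : unipotent (F := F) none = 1 := rfl
  rcases i with _ | ⟨_ | y, x⟩ <;>
    simp [coe_unipotent_none, coe_unipotent_some, h0] <;> ring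

/-- A parametrization of the elements with a single eigenvalue `1` or `-1`. -/
def signedUnipotent (i : Bool × Option (Option F × Fˣ)) : SL(2, F) :=
  bif i.1 then t (-1) * unipotent i.2 else unipotent i.2

theorem signedUnipotent_injective (hF : ringChar F ≠ 2) :
    Function.Injective (signedUnipotent (F := F)) := by
  have h4 : (2 : F) ≠ -2 := by
    have h2 : (2 : F) ≠ 0 := Ring.two_ne_zero hF
    intro h
    have : (2 : F) * 2 = 0 := by linear_combination h
    simp [h2] at this
  have hneg : ∀ i : Option (Option F × Fˣ), (t (-1) * unipotent i : SL(2, F)) 0 0 +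
      (t (-1) * unipotent i : SL(2, F)) 1 1 = -2 := by
    intro i
    rw [← trace_unipotent i]
    simp [coe_t, Matrix.mul_apply, Fin.sum_univ_two]
    ring
  rintro ⟨_ | _, i⟩ ⟨_ | _, j⟩ h <;> simp only [signedUnipotent, cond_true, cond_false] at h
  · rw [unipotent_injective h]
  · exact absurd ((trace_unipotent i).symm.trans (by rw [h]; exact hneg j)) h4
  · exact absurd ((trace_unipotent j).symm.trans (by rw [← h]; exact hneg i)) h4
  · rw [unipotent_injective (mul_left_cancel h)]

section Finite

variable [Fintype F]

theorem card_unipotent [DecidableEq F] :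
    (Fintype.card (Option (Option F × Fˣ)) : ℝ) = (Fintype.card F : ℝ) ^ 2 := by
  have : 0 < Fintype.card F := Fintype.card_pos
  rw [Fintype.card_option, Fintype.card_prod, Fintype.card_option, Fintype.card_units]
  push_cast [Nat.cast_sub (Nat.succ_le_of_lt this)]
  ring

theorem card_le [Fintype SL(2, F)] :
    (Fintype.card SL(2, F) : ℝ) ≤ Fintype.card F * ((Fintype.card F : ℝ) ^ 2 - 1) := by
  classical
  let f : (F × Fˣ) ⊕ (F × Fˣ × F) → SL(2, F) :=
    Sum.elim (fun p => u p.1 * t p.2) (fun p => u p.1 * (t p.2.1 * w) * u p.2.2)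
  have hf : Function.Surjective f := by
    intro g
    obtain ⟨x, a, rfl⟩ | ⟨x, a, y, rfl⟩ := bruhat g
    · exact ⟨Sum.inl (x, a), rfl⟩
    · exact ⟨Sum.inr (x, a, y), rfl⟩
  have h := Fintype.card_le_of_surjective f hf
  have : 0 < Fintype.card F := Fintype.card_pos
  rw [Fintype.card_sum, Fintype.card_prod, Fintype.card_prod, Fintype.card_prod,
    Fintype.card_units] at h
  have h' : (Fintype.card SL(2, F) : ℝ) ≤ _ := Nat.cast_le.2 h
  push_cast [Nat.cast_sub (Nat.succ_le_of_lt this)] at h'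
  linarith

end Finite

theorem w_mul_u_mul_w_inv (a : Fˣ) :
    u (a : F) * (w * u (a : F)⁻¹ * w⁻¹) * u (a : F) = t a * w := by
  ext i j; fin_cases i <;> fin_cases j <;>
    simp [coe_t, coe_w, coe_u, Matrix.mul_apply, Fin.sum_univ_two, Matrix.adjugate_fin_two]

/-- `SL(2, F)` has no nontrivial one-dimensional representation. -/
theorem map_eq_one {M : Type*} [CommGroup M] (hF : ∃ a : Fˣ, a ^ 2 ≠ 1) (δ : SL(2, F) →* M)
    (g : SL(2, F)) : δ g = 1 := by
  obtain ⟨a, ha⟩ := hF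
  have hu : ∀ x, δ (u x) = 1 := by
    intro x
    have ha' : (a : F) ^ 2 - 1 ≠ 0 := by
      intro h
      exact ha (Units.ext (by simpa [sub_eq_zero] using h))
    have h := congrArg δ (t_mul_u a (((a : F) ^ 2 - 1)⁻¹ * x))
    rw [map_mul, map_mul, mul_comm, mul_left_inj] at h
    have h2 : u x * u (((a : F) ^ 2 - 1)⁻¹ * x) = u ((a : F) ^ 2 * (((a : F) ^ 2 - 1)⁻¹ * x)) := by
      rw [u_mul]
      congr 1
      field_simp
      ring
    rw [← h2, map_mul] at h
    simpa using h
  have htw : ∀ a, δ (t a * w) = 1 := by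
    intro a
    rw [← w_mul_u_mul_w_inv, map_mul, map_mul, map_mul, map_mul, hu, hu, mul_one, map_inv]
    simp
  have hw : δ w = 1 := by simpa [t_one] using htw 1
  have ht : ∀ a, δ (t a) = 1 := fun a => by simpa [hw] using htw a
  obtain ⟨x, a, rfl⟩ | ⟨x, a, y, rfl⟩ := bruhat g <;> simp [hu, ht, hw]

end

section

variable {F : Type*} [Field F] {V : Type*} [AddCommGroup V] [Module ℂ V]
  {ρ : Representation ℂ SL(2, F) V}

theorem det_eq_one (hF : ∃ a : Fˣ, a ^ 2 ≠ 1) (g : SL(2, F)) : LinearMap.det (ρ g) = 1 := by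
  have := map_eq_one hF (MonoidHom.toHomUnits ((LinearMap.det (M := V) (A := ℂ)).comp ρ)) g
  exact congrArg Units.val this

theorem character_t_neg_one_mul {ε : ℂ} (hε : ∀ x, ρ (t (-1)) x = ε • x) (g : SL(2, F)) :
    ρ.character (t (-1) * g) = ε * ρ.character g := by
  have : ρ (t (-1) * g) = ε • ρ g := by
    ext x
    rw [map_mul_apply, hε, LinearMap.smul_apply]
  rw [Representation.character, this, map_smul, smul_eq_mul, Representation.character]

variable [Fintype F] {ψ : AddChar F ℂ}

/-- The central character of an irreducible representation of degree `(q - 1) / 2`. -/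
theorem t_neg_one_apply [FiniteDimensional ℂ V] (hψ : ψ.IsPrimitive) (hρ : ρ.IsIrred)
    (hF : ∃ a : Fˣ, a ^ 2 ≠ 1) {r : F} (hr : r ≠ 0) (hm : mult ψ ρ r ≠ 0) {n : ℕ}
    (hn : Module.finrank ℂ V = n + 1) (hq : 2 * (n + 1) + 1 = Fintype.card F) (x : V) :
    ρ (t (-1)) x = (-1 : ℂ) ^ n • x := by
  classical
  obtain ⟨ε, hε⟩ := hρ.exists_smul_of_commute t_neg_one_mul
  rw [hε]
  congr 1
  obtain ⟨v, hv, hv0⟩ : ∃ v, proj ψ ρ r v = v ∧ v ≠ 0 := by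
    have : LinearMap.range (proj ψ ρ r) ≠ ⊥ := fun h => hm (by rw [mult, h, finrank_bot])
    obtain ⟨_, ⟨v, rfl⟩, hv0⟩ := (Submodule.ne_bot_iff _).1 this
    exact ⟨_, proj_proj_self hψ r v, hv0⟩
  obtain ⟨g, hg⟩ := IsCyclic.exists_generator (α := Fˣ)
  have hord : orderOf g = 2 * (n + 1) := by
    rw [orderOf_eq_card_of_forall_mem_zpowers hg, Nat.card_eq_fintype_card, Fintype.card_units]
    omega
  have hgn : g ^ (n + 1) = -1 := by
    have h1 : (g ^ (n + 1)) ^ 2 = 1 := by rw [← pow_mul, mul_comm, ← hord, pow_orderOf_eq_one]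
    have h2 : g ^ (n + 1) ≠ 1 := pow_ne_one_of_lt_orderOf (by omega) (by omega)
    have h3 : ((g ^ (n + 1) : Fˣ) : F) ^ 2 = 1 := by
      rw [← Units.val_pow_eq_pow_val, h1, Units.val_one]
    refine Units.ext ((sq_eq_one_iff.1 h3).resolve_left fun h => h2 (Units.ext h))
  set e : Fin (n + 1) → V := fun j => ρ (t (g ^ (j : ℕ))) v with he
  set c : Fin (n + 1) → F := fun j => r * (((g ^ (j : ℕ))⁻¹ : Fˣ) : F) ^ 2 with hc
  have hce : ∀ j, proj ψ ρ (c j) (e j) = e j := by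
    intro j
    rw [he, hc]
    simp only
    rw [← t_proj, hv]
  have hcinj : Function.Injective c := by
    intro i j hij
    have h1 : (g ^ (i : ℕ)) ^ 2 = (g ^ (j : ℕ)) ^ 2 := by
      have := mul_left_cancel₀ hr hij
      rw [← inv_inj, ← inv_pow, ← inv_pow]
      exact Units.ext (by simpa using this)
    rw [← pow_mul, ← pow_mul] at h1
    have := pow_injOn_Iio_orderOf (x := g) (by simp [hord]; omega) (by simp [hord]; omega) h1
    exact Fin.ext (by omega)
  have hli : LinearIndependent ℂ e := by
    rw [Fintype.linearIndependent_iff]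
    intro a ha i
    have h1 := congrArg (proj ψ ρ (c i)) ha
    rw [map_sum, map_zero, Finset.sum_eq_single i] at h1
    · rw [map_smul, hce, smul_eq_zero] at h1
      refine h1.resolve_right fun h => hv0 ?_
      have : ρ (t (g ^ (i : ℕ)))⁻¹ (e i) = 0 := by rw [h, map_zero]
      rwa [he, ← map_mul_apply, inv_mul_cancel, map_one] at this
    · intro j _ hj
      rw [map_smul, ← hce j, proj_proj_of_ne hψ (hcinj.ne hj.symm), smul_zero]
    · simp
  let b := basisOfLinearIndependentOfCardEqFinrank hli (by simp [hn])
  have hb : ⇑b = e := coe_basisOfLinearIndependentOfCardEqFinrank hli _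
  have hrot : (ρ (t g) ∘ b) = fun j : Fin (n + 1) =>
      (if j = Fin.last n then ε else 1) • (b ∘ finRotate (n + 1)) j := by
    funext j
    rw [Function.comp_apply, Function.comp_apply, hb]
    simp only [he]
    rw [← map_mul_apply, t_mul, ← pow_succ']
    split_ifs with hj
    · subst hj
      rw [Fin.val_last, hgn, hε, finRotate_last]
      simp [t_one]
    · rw [coe_finRotate_of_ne_last hj, one_smul]
  have hdet := b.det_comp (ρ (t g)) b
  rw [det_eq_one hF, b.det_self, one_mul, hrot, AlternatingMap.map_smul_univ,
    AlternatingMap.map_perm, b.det_self, sign_finRotate] at hdet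
  rw [Finset.prod_ite_eq' Finset.univ (Fin.last n), if_pos (Finset.mem_univ _), Units.smul_def,
    zsmul_eq_mul, smul_eq_mul, mul_one] at hdet
  push_cast at hdet
  have hsq : ((-1 : ℂ) ^ n) * (-1) ^ n = 1 := by rw [← mul_pow]; simp
  calc ε = ε * (-1) ^ n * (-1) ^ n := by rw [mul_assoc, hsq, mul_one]
    _ = (-1) ^ n := by rw [hdet, one_mul]

end

section

variable {F : Type*} [Field F]

theorem character_unipotent {V : Type*} [AddCommGroup V] [Module ℂ V] [FiniteDimensional ℂ V]
    (ρ : Representation ℂ SL(2, F) V) (o : Option F) (x : Fˣ) :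
    ρ.character (unipotent (some (o, x))) = ρ.character (u (x : F)) :=
  ρ.char_conj _ _

theorem sum_normSq_sum_sub_one [Fintype SL(2, F)] {n : ℕ} (hn : 1 < n)
    {s : Finset (SL(2, F) → ℂ)} (hs : ↑s ⊆ irrChars F n) :
    ∑ g, Complex.normSq (∑ f ∈ s, f g - 1) = (s.card + 1) * Fintype.card SL(2, F) := by
  classical
  have : Nonempty (Fin n) := ⟨⟨0, by omega⟩⟩
  have hff : ∀ f ∈ s, ∀ f' ∈ s, ∑ g, f g * conj (f' g) =
      if f = f' then (Fintype.card SL(2, F) : ℂ) else 0 := by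
    intro f hf f' hf'
    obtain ⟨ρ, hρ, rfl⟩ := hs hf
    obtain ⟨ρ', hρ', rfl⟩ := hs hf'
    split_ifs with h
    · rw [← h]
      exact hρ.sum_character_mul_conj
    · exact hρ.sum_character_mul_conj_eq_zero hρ' h
  have hf1 : ∀ f ∈ s, ∑ g, f g = 0 := by
    intro f hf
    obtain ⟨ρ, hρ, rfl⟩ := hs hf
    have hirr : (Representation.trivial ℂ SL(2, F) ℂ).IsIrred := fun U _ => eq_bot_or_eq_top U
    have hchar : ∀ g, (Representation.trivial ℂ SL(2, F) ℂ).character g = 1 := fun g => by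
      simp [Representation.character]
    have h := hρ.sum_character_mul_conj_eq_zero hirr (fun h => by
      have h1 := congrFun h 1
      rw [hchar, Representation.char_one, Module.finrank_fin_fun] at h1
      have : n = 1 := by exact_mod_cast h1
      omega)
    simpa [hchar] using h
  have h0 : ∑ g, ∑ f ∈ s, f g = 0 := by
    rw [Finset.sum_comm]
    exact Finset.sum_eq_zero hf1
  have h1 : ∑ g, (∑ f ∈ s, f g) * conj (∑ f ∈ s, f g) = s.card * Fintype.card SL(2, F) := by
    simp only [map_sum, Finset.sum_mul_sum]
    rw [Finset.sum_comm, ← nsmul_eq_mul, ← Finset.sum_const]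
    refine Finset.sum_congr rfl fun f hf => ?_
    rw [Finset.sum_comm, Finset.sum_congr rfl (hff f hf), Finset.sum_ite_eq, if_pos hf]
  have key : ∑ g, (Complex.normSq (∑ f ∈ s, f g - 1) : ℂ) =
      (s.card + 1) * Fintype.card SL(2, F) := by
    have : ∀ g, (Complex.normSq (∑ f ∈ s, f g - 1) : ℂ) =
        (∑ f ∈ s, f g) * conj (∑ f ∈ s, f g) - ∑ f ∈ s, f g - conj (∑ f ∈ s, f g) + 1 := by
      intro g
      rw [← Complex.mul_conj, map_sub, map_one]
      ring
    simp only [this]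
    rw [Finset.sum_add_distrib, Finset.sum_sub_distrib, Finset.sum_sub_distrib, h1, h0, ← map_sum,
      h0]
    simp
    ring
  exact_mod_cast key

variable [Fintype F]

theorem two_mul_card_le_of_subset_irrChars_sub_one {n : ℕ} (hq : 3 < Fintype.card F)
    (hn : n + 1 = Fintype.card F) {s : Finset (SL(2, F) → ℂ)} (hs : ↑s ⊆ irrChars F n) :
    2 * s.card ≤ Fintype.card F := by
  classical
  have := Fintype.ofFinite SL(2, F)
  obtain ⟨ψ, hψ⟩ := exists_isPrimitive F
  have hu : ∀ f ∈ s, ∀ i, f (unipotent (some i)) = -1 := by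
    rintro f hf ⟨o, x⟩
    obtain ⟨ρ, hρ, rfl⟩ := hs hf
    have := irreducible_cases hψ hρ (by rw [Module.finrank_fin_fun]; omega)
    rw [Module.finrank_fin_fun] at this
    obtain ⟨h0, h1⟩ : mult ψ ρ 0 = 0 ∧ ∀ a ≠ 0, mult ψ ρ a = 1 := by
      rcases this with ⟨-, -, -, -, h⟩ | ⟨-, -, -, -, -, h⟩ | ⟨h, h', -⟩ | ⟨-, -, h⟩
      · omega
      · omega
      · exact ⟨h, h'⟩
      · omega
    have hsum := AddChar.sum_mulShift (x : F) hψ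
    rw [if_neg x.ne_zero, ← Finset.add_sum_erase _ _ (Finset.mem_univ (0 : F)), zero_mul,
      AddChar.map_zero_eq_one, Nat.cast_zero] at hsum
    rw [character_unipotent, character_u hψ, ← Finset.add_sum_erase _ _ (Finset.mem_univ (0 : F)),
      h0, Nat.cast_zero, mul_zero, zero_add, Finset.sum_congr rfl fun a ha => by
        rw [h1 a (Finset.ne_of_mem_erase ha), Nat.cast_one, mul_one]]
    linear_combination hsum
  have h1 : ∀ f ∈ s, f 1 = n := by
    intro f hf
    obtain ⟨ρ, hρ, rfl⟩ := hs hf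
    rw [Representation.char_one, Module.finrank_fin_fun]
  have hs1 : ∑ f ∈ s, f (unipotent none) = ∑ f ∈ s, (n : ℂ) := Finset.sum_congr rfl h1
  have hs2 : ∀ i, ∑ f ∈ s, f (unipotent (some i)) = ∑ f ∈ s, (-1 : ℂ) := fun i =>
    Finset.sum_congr rfl fun f hf => hu f hf i
  have key := Fintype.sum_comp_le_sum_of_injective unipotent_injective
    (f := fun g => Complex.normSq (∑ f ∈ s, f g - 1)) (fun _ => Complex.normSq_nonneg _)
  rw [sum_normSq_sum_sub_one (by omega) hs, Fintype.sum_option, hs1] at key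
  simp only [hs2] at key
  have hnq : (n : ℝ) = Fintype.card F - 1 := by rw [← hn]; simp
  have hc := card_unipotent (F := F)
  rw [Fintype.card_option, Nat.cast_add_one, ← eq_sub_iff_add_eq] at hc
  have hG := card_le (F := F)
  by_contra! hlt
  have hlt' : (Fintype.card F : ℝ) + 1 ≤ 2 * (s.card : ℝ) := by exact_mod_cast hlt
  have hq' : (3 : ℝ) < Fintype.card F := by exact_mod_cast hq
  set q : ℝ := (Fintype.card F : ℝ)
  set k : ℝ := (s.card : ℝ) with hk
  have e1 : Complex.normSq (∑ f ∈ s, (n : ℂ) - 1) = (k * (q - 1) - 1) ^ 2 := by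
    rw [← hnq, sq, ← Complex.normSq_ofReal]
    congr 1
    simp [hk]
  have e2 : Complex.normSq (∑ f ∈ s, (-1 : ℂ) - 1) = (k + 1) ^ 2 := by
    rw [sq, ← neg_mul_neg, ← Complex.normSq_ofReal]
    congr 1
    simp [hk]
    ring
  rw [e1, e2, Finset.sum_const, Finset.card_univ, nsmul_eq_mul, hc] at key
  have h2 : (k + 1) * (Fintype.card SL(2, F) : ℝ) ≤ (k + 1) * (q * (q ^ 2 - 1)) := by gcongr
  have h3 : 0 ≤ k * (q * (q - 1)) * (2 * k - q - 1) :=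
    mul_nonneg (by have : 0 < q - 1 := by linarith
                   positivity) (by linarith)
  have h4 : 0 ≤ (q * (q - 1)) * (2 * k - q - 1) :=
    mul_nonneg (mul_nonneg (by linarith) (by linarith)) (by linarith)
  nlinarith

end

section

variable {F : Type*} [Field F] [Fintype F] {V V' : Type*} [AddCommGroup V] [Module ℂ V]
  [FiniteDimensional ℂ V] [AddCommGroup V'] [Module ℂ V'] [FiniteDimensional ℂ V']
  {ρ : Representation ℂ SL(2, F) V} {ρ' : Representation ℂ SL(2, F) V'} {ψ : AddChar F ℂ}

theorem sum_normSq_character_u (hψ : ψ.IsPrimitive) :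
    ∑ x, Complex.normSq (ρ.character (u x)) = Fintype.card F * ∑ a, (mult ψ ρ a : ℝ) ^ 2 := by
  have hm : ∀ a, ∑ x, ψ (-(a * x)) * ρ.character (u x) = Fintype.card F * mult ψ ρ a := by
    intro a
    rw [← trace_proj hψ, proj, map_smul, map_sum, smul_eq_mul, mul_inv_cancel_left₀ card_ne_zero]
    simp [Representation.character]
  have h : ∑ x, (Complex.normSq (ρ.character (u x)) : ℂ) =
      Fintype.card F * ∑ a, (mult ψ ρ a : ℂ) ^ 2 := by
    calc
      _ = ∑ x, ∑ a, ρ.character (u x) * (ψ (-(a * x)) * mult ψ ρ a) := by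
        refine Finset.sum_congr rfl fun x _ => ?_
        rw [← Complex.mul_conj, ← Representation.character_inv,
          inv_eq_of_mul_eq_one_right (b := u (-x)) (by rw [u_mul, add_neg_cancel, u_zero]),
          character_u hψ (-x), Finset.mul_sum]
        simp only [mul_neg]
      _ = _ := by
        rw [Finset.sum_comm, Finset.mul_sum]
        refine Finset.sum_congr rfl fun a _ => ?_
        rw [sq, ← mul_assoc, ← hm, Finset.sum_mul]
        exact Finset.sum_congr rfl fun x _ => by ring
  exact_mod_cast h

theorem sum_normSq_character_unipotent (hψ : ψ.IsPrimitive) [DecidableEq F] :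
    ∑ i, Complex.normSq (ρ.character (unipotent i)) = (Module.finrank ℂ V : ℝ) ^ 2 +
      (Fintype.card F + 1) * (Fintype.card F * ∑ a, (mult ψ ρ a : ℝ) ^ 2 -
        (Module.finrank ℂ V : ℝ) ^ 2) := by
  have h1 : Complex.normSq (ρ.character (1 : SL(2, F))) = (Module.finrank ℂ V : ℝ) ^ 2 := by
    rw [Representation.char_one, Complex.normSq_natCast, sq]
  have hx : ∑ x : Fˣ, Complex.normSq (ρ.character (u (x : F))) =
      Fintype.card F * ∑ a, (mult ψ ρ a : ℝ) ^ 2 - (Module.finrank ℂ V : ℝ) ^ 2 := by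
    rw [← sum_normSq_character_u hψ,
      Fintype.sum_eq_add_sum_subtype_ne (fun x => Complex.normSq (ρ.character (u x))) 0, u_zero, h1,
      add_sub_cancel_left]
    exact Fintype.sum_equiv unitsEquivNeZero _ _ fun x => rfl
  rw [Fintype.sum_option, Fintype.sum_prod_type, show unipotent (F := F) none = 1 from rfl, h1]
  simp only [character_unipotent, hx]
  rw [Finset.sum_const, Finset.card_univ, Fintype.card_option, nsmul_eq_mul, Nat.cast_add_one]

theorem sum_normSq_character_signedUnipotent (hψ : ψ.IsPrimitive) [DecidableEq F] {ε : ℂ}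
    (hε : ∀ x, ρ (t (-1)) x = ε • x) (h1 : Complex.normSq ε = 1) :
    ∑ i, Complex.normSq (ρ.character (signedUnipotent i)) = 2 * ((Module.finrank ℂ V : ℝ) ^ 2 +
      (Fintype.card F + 1) * (Fintype.card F * ∑ a, (mult ψ ρ a : ℝ) ^ 2 -
        (Module.finrank ℂ V : ℝ) ^ 2)) := by
  rw [Fintype.sum_prod_type, Fintype.sum_bool]
  simp only [signedUnipotent, cond_true, cond_false, character_t_neg_one_mul hε, map_mul, h1,
    one_mul]
  rw [sum_normSq_character_unipotent hψ]
  ring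

theorem character_eq_of_signedUnipotent [Nontrivial V] [Nontrivial V'] (hρ : ρ.IsIrred)
    (hρ' : ρ'.IsIrred) (hψ : ψ.IsPrimitive) [DecidableEq F] (hF : ringChar F ≠ 2)
    (hq : 2 * Module.finrank ℂ V + 1 = Fintype.card F) (hm : ∀ a, mult ψ ρ a ≤ 1)
    (hm' : ∀ a, mult ψ ρ a = mult ψ ρ' a) {ε : ℂ} (h1 : Complex.normSq ε = 1)
    (hε : ∀ x, ρ (t (-1)) x = ε • x) (hε' : ∀ x, ρ' (t (-1)) x = ε • x) :
    ρ.character = ρ'.character := by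
  have := Fintype.ofFinite SL(2, F)
  by_contra hne
  have hu : ∀ i, ρ.character (unipotent i) = ρ'.character (unipotent i) := by
    rintro (_ | ⟨o, x⟩)
    · rw [show unipotent (F := F) none = 1 from rfl, Representation.char_one,
        Representation.char_one, finrank_eq_sum_mult hψ (ρ := ρ), finrank_eq_sum_mult hψ (ρ := ρ')]
      simp only [hm']
    · simp only [character_unipotent, character_u hψ, hm']
  have hs : ∀ i, ρ.character (signedUnipotent i) = ρ'.character (signedUnipotent i) := by
    rintro ⟨_ | _, i⟩ <;> simp only [signedUnipotent, cond_true, cond_false, hu,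
      character_t_neg_one_mul hε, character_t_neg_one_mul hε']
  have hnorm : ∑ g, Complex.normSq (ρ.character g + ρ'.character g) =
      2 * Fintype.card SL(2, F) := by
    have : ∑ g, (Complex.normSq (ρ.character g + ρ'.character g) : ℂ) =
        2 * Fintype.card SL(2, F) := by
      simp only [← Complex.mul_conj, map_add, add_mul, mul_add, Finset.sum_add_distrib]
      rw [hρ.sum_character_mul_conj, hρ'.sum_character_mul_conj,
        hρ.sum_character_mul_conj_eq_zero hρ' hne,
        hρ'.sum_character_mul_conj_eq_zero hρ (Ne.symm hne)]
      ring
    exact_mod_cast this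
  have key := Fintype.sum_comp_le_sum_of_injective (signedUnipotent_injective hF)
    (f := fun g => Complex.normSq (ρ.character g + ρ'.character g))
    (fun _ => Complex.normSq_nonneg _)
  simp only [← hs, ← two_mul, map_mul, ← Finset.mul_sum] at key
  have h2 : Complex.normSq 2 = 4 := by
    rw [Complex.normSq_ofNat]
    norm_num
  have hsum : ∑ a, (mult ψ ρ a : ℝ) ^ 2 = Module.finrank ℂ V := by
    rw [finrank_eq_sum_mult (ρ := ρ) hψ, Nat.cast_sum]
    refine Finset.sum_congr rfl fun a _ => ?_
    rcases Nat.le_one_iff_eq_zero_or_eq_one.1 (hm a) with h | h <;> simp [h]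
  rw [hnorm, sum_normSq_character_signedUnipotent hψ hε h1, h2, hsum] at key
  have hG := card_le (F := F)
  have hn : (0 : ℝ) < Module.finrank ℂ V := Nat.cast_pos.2 Module.finrank_pos
  rw [← hq] at hG key
  push_cast at hG key
  nlinarith

theorem card_le_two_of_subset_irrChars {n : ℕ} (hq : 3 < Fintype.card F)
    (hn : 2 * n + 1 = Fintype.card F) {s : Finset (SL(2, F) → ℂ)} (hs : ↑s ⊆ irrChars F n) :
    s.card ≤ 2 := by
  classical
  obtain ⟨ψ, hψ⟩ := exists_isPrimitive F
  have hF : ringChar F ≠ 2 := fun h => by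
    have := FiniteField.even_card_iff_char_two.1 h
    omega
  have hF' : ∃ a : Fˣ, a ^ 2 ≠ 1 := by
    by_contra! h
    obtain ⟨g, hg⟩ := IsCyclic.exists_ofOrder_eq_natCard (α := Fˣ)
    have := Nat.le_of_dvd two_pos (orderOf_dvd_of_pow_eq_one (h g))
    rw [hg, Nat.card_eq_fintype_card, Fintype.card_units] at this
    omega
  have hcases : ∀ {ρ : Representation ℂ SL(2, F) (Fin n → ℂ)}, ρ.IsIrred → mult ψ ρ 0 = 0 ∧
      ∀ a ≠ 0, mult ψ ρ a = if IsSquare a then mult ψ ρ 1 else 1 - mult ψ ρ 1 := by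
    intro ρ hρ
    have := irreducible_cases hψ hρ (by rw [Module.finrank_fin_fun]; omega)
    rw [Module.finrank_fin_fun] at this
    rcases this with ⟨-, -, -, -, h⟩ | ⟨-, -, -, -, -, h⟩ | ⟨-, -, h⟩ | ⟨h, h', -⟩
    · omega
    · omega
    · omega
    · exact ⟨h, h'⟩
  refine Finset.card_le_card_of_forall_subsingleton (t := {0, 1})
    (fun (f : SL(2, F) → ℂ) (m : ℕ) => ∃ ρ : Representation ℂ SL(2, F) (Fin n → ℂ), ρ.IsIrred ∧
      f = ρ.character ∧ mult ψ ρ 1 = m) ?_ ?_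
  · intro f hf
    obtain ⟨ρ, hρ, rfl⟩ := hs hf
    refine ⟨mult ψ ρ 1, ?_, ρ, hρ, rfl, rfl⟩
    rcases Nat.le_one_iff_eq_zero_or_eq_one.1 (mult_le_one_of_ne_zero hψ hρ one_ne_zero)
      with h | h <;> simp [h]
  · rintro m - f ⟨-, ρ, hρ, rfl, h⟩ f' ⟨-, ρ', hρ', rfl, h'⟩
    obtain ⟨k, rfl⟩ : ∃ k, n = k + 1 := ⟨n - 1, by omega⟩
    have hm' : ∀ a, mult ψ ρ a = mult ψ ρ' a := by
      intro a
      by_cases ha : a = 0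
      · rw [ha, (hcases hρ).1, (hcases hρ').1]
      · rw [(hcases hρ).2 a ha, (hcases hρ').2 a ha, h, h']
    obtain ⟨r, hr⟩ : ∃ r, mult ψ ρ r ≠ 0 := by
      by_contra! h0
      have := finrank_eq_sum_mult (ρ := ρ) hψ
      rw [Module.finrank_fin_fun, Finset.sum_eq_zero fun a _ => h0 a] at this
      omega
    have hr0 : r ≠ 0 := by
      rintro rfl
      exact hr (hcases hρ).1
    have hm : ∀ a, mult ψ ρ a ≤ 1 := by
      intro a
      by_cases ha : a = 0
      · rw [ha, (hcases hρ).1]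
        exact zero_le_one
      · exact mult_le_one_of_ne_zero hψ hρ ha
    exact character_eq_of_signedUnipotent hρ hρ' hψ hF (by rwa [Module.finrank_fin_fun]) hm hm'
      (ε := (-1) ^ k) (by simp) (t_neg_one_apply hψ hρ hF' hr0 hr (Module.finrank_fin_fun _) hn)
      (t_neg_one_apply hψ hρ' hF' hr0 (hm' r ▸ hr) (Module.finrank_fin_fun _) hn)

end

/-- An upper bound for the number of irreducible characters of `SL(2, F)` of degree `n`, where `F`
has `q` elements. -/
def degreeBound (n q : ℕ) : ℕ :=
  if n = q + 1 then (q - 2) / 2 else if n + 1 = q then q / 2 else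
    if n = q ∨ 2 * n = q + 1 then 3 else if 2 * n + 1 = q then 2 else 0

theorem card_le_degreeBound {F : Type*} [Field F] [Fintype F] {n : ℕ} (hn : 1 < n)
    (hq : 3 < Fintype.card F) {s : Finset (SL(2, F) → ℂ)} (hs : ↑s ⊆ irrChars F n) :
    s.card ≤ degreeBound n (Fintype.card F) := by
  classical
  unfold degreeBound
  split_ifs with h1 h2 h3 h4
  · subst h1
    have := two_mul_card_le_of_subset_irrChars_add_one (by omega) hs
    omega
  · have := two_mul_card_le_of_subset_irrChars_sub_one hq h2 hs
    omega
  · exact card_le_three_of_subset_irrChars hq h3 hs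
  · exact card_le_two_of_subset_irrChars hq h4 hs
  · rw [Nat.le_zero, Finset.card_eq_zero, Finset.eq_empty_iff_forall_notMem]
    intro f hf
    obtain ⟨ρ, hρ, -⟩ := hs hf
    obtain ⟨ψ, hψ⟩ := exists_isPrimitive F
    have := irreducible_cases hψ hρ (by rwa [Module.finrank_fin_fun])
    rw [Module.finrank_fin_fun] at this
    rcases this with ⟨-, -, -, -, h⟩ | ⟨-, -, -, -, -, h⟩ | ⟨-, -, h⟩ | ⟨-, -, h⟩ <;> omega

theorem sum_degreeBound_le {n : ℕ} (hn : 20 ≤ n) {Q : Finset ℕ} (hQ : ∀ q ∈ Q, IsPrimePow q) :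
    ∑ q ∈ Q, degreeBound n q ≤ n + 3 := by
  classical
  let T : Finset ℕ := {n - 1, n, n + 1, 2 * n - 1, 2 * n + 1}
  have hle : ∑ q ∈ Q, degreeBound n q ≤ ∑ q ∈ T, if IsPrimePow q then degreeBound n q else 0 := by
    rw [← Finset.sum_filter]
    refine Finset.sum_le_sum_of_ne_zero fun q hq h => ?_
    rw [Finset.mem_filter]
    refine ⟨?_, hQ q hq⟩
    by_contra hT
    simp only [T, Finset.mem_insert, Finset.mem_singleton, not_or] at hT
    refine h ?_
    unfold degreeBound
    split_ifs <;> omega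
  have h1 : degreeBound n (n - 1) = (n - 3) / 2 := by unfold degreeBound; split_ifs <;> omega
  have h2 : degreeBound n n = 3 := by unfold degreeBound; split_ifs <;> omega
  have h3 : degreeBound n (n + 1) = (n + 1) / 2 := by unfold degreeBound; split_ifs <;> omega
  have h4 : degreeBound n (2 * n - 1) = 3 := by unfold degreeBound; split_ifs <;> omega
  have h5 : degreeBound n (2 * n + 1) = 2 := by unfold degreeBound; split_ifs <;> omega
  refine hle.trans ?_
  simp only [T]
  rw [Finset.sum_insert (by simp; omega), Finset.sum_insert (by simp; omega),
    Finset.sum_insert (by simp; omega), Finset.sum_insert (by grind), Finset.sum_singleton,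
    h1, h2, h3, h4, h5]
  rcases Nat.mod_two_eq_zero_or_one n with hp | hp
  · have := not_isPrimePow_pred_and_self_and_succ (by omega) hp
    split_ifs <;> first | omega | tauto
  · have := not_isPrimePow_pred_and_succ (by omega) hp
    split_ifs <;> first | omega | tauto

end SL2

theorem count_SL2_complex_characters (n : ℕ) (hn : 250 < n)
    (F : ℕ → Type*) [∀ q, Field (F q)] [∀ q, Fintype (F q)]
    (hF : ∀ q, IsPrimePow q → Fintype.card (F q) = q) :
    Nat.card ((q : {q : ℕ // IsPrimePow q ∧ 250 < q}) ×
      {χ : Matrix.SpecialLinearGroup (Fin 2) (F q) → ℂ //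
        ∃ ρ : Representation ℂ (Matrix.SpecialLinearGroup (Fin 2) (F q)) (Fin n → ℂ),
          ρ.IsIrred ∧ χ = fun g => LinearMap.trace ℂ (Fin n → ℂ) (ρ g)}) ≤ n + 3 := by
  classical
  refine Nat.card_le_of_forall_finset_card_le fun S => ?_
  rw [← S.sigma_image_fst_preimage_mk, Finset.card_sigma]
  calc
    _ ≤ ∑ q ∈ S.image Sigma.fst, SL2.degreeBound n q := by
      refine Finset.sum_le_sum fun q _ => ?_
      rw [← Finset.card_map (Function.Embedding.subtype _)]
      have hq := hF q q.2.1
      have := SL2.card_le_degreeBound (F := F q) (n := n) (by omega) (by rw [hq]; omega)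
        (s := (S.preimage (Sigma.mk q) sigma_mk_injective.injOn).map
          (Function.Embedding.subtype _)) (by
            intro f hf
            obtain ⟨χ, -, rfl⟩ := Finset.mem_map.1 hf
            exact χ.2)
      rwa [hq] at this
    _ = ∑ q ∈ (S.image Sigma.fst).map (Function.Embedding.subtype _), SL2.degreeBound n q := by
      rw [Finset.sum_map]
      rfl
    _ ≤ n + 3 := by
      refine SL2.sum_degreeBound_le (by omega) fun q hq => ?_
      obtain ⟨q, -, rfl⟩ := Finset.mem_map.1 hq
      exact q.2.1
end

section
/- Let k be an algebraically closed field (of arbitrary characteristic) and let n > 250 be an integer. Then the number of integers d ≥ 5 such that the alternating group Alt(d) has an irreducible k-linear representation of dimension n is strictly less than 2√n + 14. -/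
namespace AltDegrees

open Module

universe u v w

/-- Every nontrivial representation of `G` over `k` has dimension at least `m`. -/
def MinDegree (k : Type u) [Field k] (G : Type v) [Group G] (m : ℕ) : Prop :=
  ∀ (V : Type u) [AddCommGroup V] [Module k V] [FiniteDimensional k V]
    (ρ : Representation k G V), (∃ g, ρ g ≠ 1) → m ≤ finrank k V

section Algebra

variable {k : Type u} [Field k]

theorem finite_hom {A : Type v} [Ring A] [Algebra k A]
    {X W : Type*} [AddCommGroup X] [Module k X] [Module A X] [IsScalarTower k A X]
    [FiniteDimensional k X]
    [AddCommGroup W] [Module k W] [Module A W] [IsScalarTower k A W] [FiniteDimensional k W] :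
    Module.Finite k (X →ₗ[A] W) :=
  .of_injective (LinearMap.restrictScalarsₗ k A X W k) (LinearMap.restrictScalars_injective _)

theorem finrank_hom_mul_finrank_le [IsAlgClosed k] {A : Type v} [Ring A] [Algebra k A]
    {X W : Type u} [AddCommGroup X] [Module k X] [Module A X] [IsScalarTower k A X]
    [FiniteDimensional k X] [IsSimpleModule A X]
    [AddCommGroup W] [Module k W] [Module A W] [IsScalarTower k A W] [FiniteDimensional k W] :
    finrank k (X →ₗ[A] W) * finrank k X ≤ finrank k W := by
  have : Module.Finite k (X →ₗ[A] W) := finite_hom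
  let b := Module.finBasis k (X →ₗ[A] W)
  let Φ : (Fin (finrank k (X →ₗ[A] W)) → X) →ₗ[A] W := ∑ i, (b i) ∘ₗ LinearMap.proj i
  have hΦ : ∀ x, Φ x = ∑ i, b i (x i) := fun x ↦ by simp [Φ]
  suffices h : Function.Injective Φ by
    have := LinearMap.finrank_le_finrank_of_injective (f := Φ.restrictScalars k) h
    rwa [Module.finrank_pi_fintype, Finset.sum_const, Finset.card_univ, Fintype.card_fin,
      smul_eq_mul] at this
  rw [← LinearMap.ker_eq_bot]
  by_contra hne
  have : IsArtinian A (Fin (finrank k (X →ₗ[A] W)) → X) := isArtinian_of_tower k inferInstance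
  obtain ⟨L, hL, hLK⟩ := (eq_bot_or_exists_atom_le (LinearMap.ker Φ)).resolve_left hne
  have : IsSimpleModule A L := isSimpleModule_iff_isAtom.mpr hL
  obtain ⟨i₀, hi₀⟩ : ∃ i, (LinearMap.proj i : (_ → X) →ₗ[A] X) ∘ₗ L.subtype ≠ 0 := by
    by_contra! h
    refine hL.1 ((Submodule.eq_bot_iff _).2 fun x hx ↦ funext fun i ↦ ?_)
    exact congr($(h i) ⟨x, hx⟩)
  let e := LinearEquiv.ofBijective _ (LinearMap.bijective_of_ne_zero hi₀)
  have hc : ∀ i, ∃ c : k, ∀ x, (e.symm x).1 i = c • x := fun i ↦ by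
    obtain ⟨c, hc⟩ := (IsSimpleModule.algebraMap_end_bijective_of_isAlgClosed (A := A) (V := X) k).2
      ((LinearMap.proj i ∘ₗ L.subtype) ∘ₗ e.symm.toLinearMap)
    exact ⟨c, fun x ↦ congr($hc.symm x)⟩
  choose c hc using hc
  have h0 : ∑ i, c i • b i = 0 := by
    ext x
    have h : Φ (e.symm x).1 = 0 := hLK (e.symm x).2
    rw [hΦ] at h
    simp only [hc] at h
    rw [LinearMap.zero_apply, ← h, LinearMap.sum_apply]
    refine Finset.sum_congr rfl fun i _ ↦ ?_
    rw [LinearMap.smul_apply]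
    exact ((b i).map_smul_of_tower (c i) x).symm
  have hc0 : c i₀ = 0 := Fintype.linearIndependent_iff.1 b.linearIndependent c h0 i₀
  refine hi₀ (LinearMap.ext fun x ↦ ?_)
  have h1 : e x = (e.symm (e x)).1 i₀ := by rw [e.symm_apply_apply]; rfl
  rw [hc, hc0, zero_smul] at h1
  exact h1

variable {G₁ G₂ : Type*} [Group G₁] [Group G₂]

theorem mul_le_finrank_of_span_eq_top [IsAlgClosed k] {m₁ m₂ : ℕ}
    (h₁ : MinDegree k G₁ m₁) (h₂ : MinDegree k G₂ m₂)
    {A : Type v} [Ring A] [Algebra k A]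
    {X V : Type u} [AddCommGroup X] [Module k X] [Module A X] [IsScalarTower k A X]
    [FiniteDimensional k X] [IsSimpleModule A X]
    [AddCommGroup V] [Module k V] [Module A V] [IsScalarTower k A V] [FiniteDimensional k V]
    (σ : G₁ →* A) (T : G₂ →* Module.End A V)
    (hspan : Submodule.span k {v | ∃ (f : X →ₗ[A] V) (x : X), f x = v} = ⊤)
    (n₁ : ∃ g, ∃ v : V, σ g • v ≠ v) (n₂ : ∃ h, T h ≠ 1) : m₁ * m₂ ≤ finrank k V := by
  have : Module.Finite k (X →ₗ[A] V) := finite_hom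
  have ext_V (φ : V →ₗ[k] V) (hφ : ∀ (f : X →ₗ[A] V) x, φ (f x) = f x) (v : V) : φ v = v := by
    refine congr($(LinearMap.ext_on (g := LinearMap.id) hspan ?_) v)
    rintro _ ⟨f, x, rfl⟩
    exact hφ f x
  let ρX : Representation k G₁ X := ((Algebra.lsmul k k X : A →ₐ[k] Module.End k X) :
    A →* Module.End k X).comp σ
  let ρH : Representation k G₂ (X →ₗ[A] V) :=
    { toFun := fun h ↦
        { toFun := fun f ↦ T h ∘ₗ f
          map_add' := fun f f' ↦ by ext; simp
          map_smul' := fun c f ↦ by ext; exact (T h).map_smul_of_tower c _ }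
      map_one' := by ext; simp
      map_mul' := fun h h' ↦ by ext; simp }
  have d₁ := h₁ X ρX <| by
    by_contra! h
    obtain ⟨g, v, hg⟩ := n₁
    refine hg (ext_V (Algebra.lsmul k k V (σ g)) (fun f x ↦ ?_) v)
    have hx : σ g • x = x := congr($(h g) x)
    rw [Algebra.lsmul_apply, ← map_smul, hx]
  have d₂ := h₂ (X →ₗ[A] V) ρH <| by
    by_contra! h
    obtain ⟨g, hg⟩ := n₂
    exact hg (LinearMap.ext fun v ↦
      ext_V ((T g).restrictScalars k) (fun f x ↦ congr($(h g) f x)) v)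
  calc m₁ * m₂ = m₂ * m₁ := mul_comm _ _
    _ ≤ _ := Nat.mul_le_mul d₂ d₁
    _ ≤ _ := finrank_hom_mul_finrank_le

theorem mul_le_finrank_of_irreducible [IsAlgClosed k] {m₁ m₂ : ℕ}
    (h₁ : MinDegree k G₁ m₁) (h₂ : MinDegree k G₂ m₂)
    {V : Type u} [AddCommGroup V] [Module k V] [FiniteDimensional k V]
    (ρ₁ : Representation k G₁ V) (ρ₂ : Representation k G₂ V)
    (comm : ∀ g h v, ρ₁ g (ρ₂ h v) = ρ₂ h (ρ₁ g v))
    (irr : ∀ U : Submodule k V, (∀ g, U ≤ U.comap (ρ₁ g)) → (∀ h, U ≤ U.comap (ρ₂ h)) →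
      U = ⊥ ∨ U = ⊤)
    (n₁ : ∃ g, ρ₁ g ≠ 1) (n₂ : ∃ h, ρ₂ h ≠ 1) : m₁ * m₂ ≤ finrank k V := by
  let A := Algebra.adjoin k (Set.range ρ₁)
  let σ : G₁ →* A := ρ₁.codRestrict A fun g ↦ Algebra.subset_adjoin ⟨g, rfl⟩
  have comm_A (a : A) (h) (v : V) : ρ₂ h (a • v) = a • ρ₂ h v := by
    have : A ≤ Subalgebra.centralizer k {ρ₂ h} := Algebra.adjoin_le <| by
      rintro _ ⟨g, rfl⟩
      rw [SetLike.mem_coe, Subalgebra.mem_centralizer_iff]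
      rintro _ rfl
      exact LinearMap.ext fun v ↦ (comm g h v).symm
    exact congr($((Subalgebra.mem_centralizer_iff k).1 (this a.2) _ rfl) v)
  let T : G₂ →* Module.End A V :=
    { toFun := fun h ↦
        { toFun := ρ₂ h, map_add' := map_add _, map_smul' := (comm_A · h) }
      map_one' := by ext; simp
      map_mul' := fun h h' ↦ by ext; simp }
  have : IsArtinian A V := isArtinian_of_tower k inferInstance
  have hV : (⊤ : Submodule A V) ≠ ⊥ := by
    obtain ⟨g, hg⟩ := n₁
    refine fun h ↦ hg (LinearMap.ext fun v ↦ ?_)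
    have hv (v : V) : v = 0 := (Submodule.eq_bot_iff _).1 h v trivial
    rw [hv v, map_zero, map_zero]
  obtain ⟨X, hX, -⟩ := (eq_bot_or_exists_atom_le (⊤ : Submodule A V)).resolve_left hV
  have : IsSimpleModule A X := isSimpleModule_iff_isAtom.mpr hX
  have : FiniteDimensional k X := inferInstanceAs (FiniteDimensional k (X.restrictScalars k))
  refine mul_le_finrank_of_span_eq_top h₁ h₂ (X := X) σ T ?_ ?_ ?_
  · refine (irr _ (fun g ↦ Submodule.span_le.2 ?_) (fun h ↦ Submodule.span_le.2 ?_)).resolve_left ?_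
    · rintro _ ⟨f, x, rfl⟩
      exact Submodule.subset_span ⟨f, σ g • x, map_smul f _ _⟩
    · rintro _ ⟨f, x, rfl⟩
      exact Submodule.subset_span ⟨T h ∘ₗ f, x, rfl⟩
    · intro h
      refine hX.1 ((Submodule.eq_bot_iff _).2 fun x hx ↦ ?_)
      exact (Submodule.eq_bot_iff _).1 h x (Submodule.subset_span ⟨X.subtype, ⟨x, hx⟩, rfl⟩)
  · obtain ⟨g, hg⟩ := n₁
    by_contra! h
    exact hg (LinearMap.ext (h g))
  · obtain ⟨g, hg⟩ := n₂
    exact ⟨g, fun h ↦ hg (LinearMap.ext fun v ↦ congr($h v))⟩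

theorem apply_eq_self_of_perfect {G V : Type*} [Group G] (hG : commutator G = ⊤)
    [AddCommGroup V] [Module k V] (ρ : Representation k G V) (v : V)
    (h : ∀ g g', ρ g (ρ g' v - v) = ρ g' v - v) (g : G) : ρ g v = v := by
  let φ : G →* Multiplicative V :=
    { toFun := fun g ↦ .ofAdd (ρ g v - v)
      map_one' := by simp
      map_mul' := fun a b ↦ by
        rw [← ofAdd_add]
        congr 1
        have := h a b
        rw [map_sub] at this
        rw [map_mul, Module.End.mul_apply, sub_eq_iff_eq_add.1 this]
        abel }
  have : g ∈ φ.ker := Abelianization.commutator_subset_ker φ (hG ▸ Subgroup.mem_top g)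
  exact sub_eq_zero.1 (congrArg Multiplicative.toAdd this)

theorem apply_sub_eq_of_finrank_lt [IsAlgClosed k] {m₁ m₂ : ℕ}
    (h₁ : MinDegree k G₁ m₁) (h₂ : MinDegree k G₂ m₂)
    (p₁ : commutator G₁ = ⊤) (p₂ : commutator G₂ = ⊤)
    {V : Type u} [AddCommGroup V] [Module k V] [FiniteDimensional k V]
    (ρ₁ : Representation k G₁ V) (ρ₂ : Representation k G₂ V)
    (comm : ∀ g h v, ρ₁ g (ρ₂ h v) = ρ₂ h (ρ₁ g v))
    (hV : finrank k V < m₁ * m₂) (g : G₁) (h : G₂) (v : V) :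
    ρ₁ g (ρ₂ h v - v) = ρ₂ h v - v := by
  induction hn : finrank k V using Nat.strong_induction_on generalizing V g h v with
  | _ n ih =>
  by_cases irr : ∀ U : Submodule k V, (∀ g, U ≤ U.comap (ρ₁ g)) → (∀ h, U ≤ U.comap (ρ₂ h)) →
      U = ⊥ ∨ U = ⊤
  · by_cases n₁ : ∃ g, ρ₁ g ≠ 1
    · by_cases n₂ : ∃ g, ρ₂ g ≠ 1
      · exact absurd (mul_le_finrank_of_irreducible h₁ h₂ ρ₁ ρ₂ comm irr n₁ n₂) hV.not_ge
      · push Not at n₂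
        simp [n₂]
    · push Not at n₁
      simp [n₁]
  · push Not at irr
    obtain ⟨U, hU₁, hU₂, hbot, htop⟩ := irr
    have dU : finrank k U < finrank k V := Submodule.finrank_lt htop
    have dQ : finrank k (V ⧸ U) < finrank k V := by
      have h0 : 0 < finrank k U := by
        rw [pos_iff_ne_zero]
        exact fun h ↦ hbot (Submodule.finrank_eq_zero.1 h)
      have := U.finrank_quotient_add_finrank
      omega
    have iU : ∀ g h, ∀ v ∈ U, ρ₁ g (ρ₂ h v - v) = ρ₂ h v - v := fun g h v hv ↦
      congrArg Subtype.val (ih _ (hn ▸ dU) (ρ₁.subrepresentation U hU₁)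
        (ρ₂.subrepresentation U hU₂) (fun g h v ↦ Subtype.ext (comm g h v))
        (dU.trans hV) g h ⟨v, hv⟩ rfl)
    have iQ : ∀ g h v, ρ₁ g (ρ₂ h v - v) - (ρ₂ h v - v) ∈ U := fun g h v ↦ by
      rw [← Submodule.Quotient.eq]
      exact ih _ (hn ▸ dQ) (ρ₁.quotient U hU₁) (ρ₂.quotient U hU₂)
        (fun g h v ↦ by
          obtain ⟨v, rfl⟩ := U.mkQ_surjective v
          exact congrArg U.mkQ (comm g h v))
        (dQ.trans hV) g h (U.mkQ v) rfl
    have key : ∀ g' h' g h v, ρ₁ g' (ρ₂ h' (ρ₁ g (ρ₂ h v - v) - (ρ₂ h v - v)) -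
        (ρ₁ g (ρ₂ h v - v) - (ρ₂ h v - v))) = _ := fun g' h' g h v ↦ iU g' h' _ (iQ g h v)
    refine apply_eq_self_of_perfect p₁ ρ₁ _ (fun g' g ↦ ?_) g
    have := apply_eq_self_of_perfect p₂ ρ₂
      (ρ₁ g' (ρ₁ g v - v) - (ρ₁ g v - v)) (fun h' h ↦ ?_) h
    · rw [← sub_eq_zero] at this ⊢
      rw [← this]
      simp only [map_sub, comm]
      abel
    · have := key g' h' g h v
      rw [← sub_eq_zero] at this ⊢
      rw [← this]
      simp only [map_sub, comm]
      abel

end Algebra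

section Permutations

variable {α : Type*} [Fintype α] [DecidableEq α]

open Equiv Equiv.Perm

theorem exists_alternating_map {n : ℕ} (f g : Fin n ↪ α) (hn : n + 2 ≤ Fintype.card α) :
    ∃ σ : alternatingGroup α, ∀ i, σ.1 (f i) = g i := by
  have := alternatingGroup.isMultiplyPretransitive α
  rw [Nat.card_eq_fintype_card] at this
  have : MulAction.IsMultiplyPretransitive (alternatingGroup α) α n :=
    MulAction.isMultiplyPretransitive_of_le (n := Fintype.card α - 2) (by omega)
      (by rw [Nat.card_eq_fintype_card]; omega)
  obtain ⟨σ, hσ⟩ := MulAction.exists_smul_eq (alternatingGroup α) f g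
  exact ⟨σ, fun i ↦ DFunLike.congr_fun hσ i⟩

theorem exists_alternating_map_two (hα : 4 ≤ Fintype.card α) {a b a' b' : α}
    (h : a ≠ b) (h' : a' ≠ b') : ∃ σ : alternatingGroup α, σ.1 a = a' ∧ σ.1 b = b' := by
  have inj : ∀ {a b : α}, a ≠ b → Function.Injective ![a, b] := by
    intro a b hab i j hij
    fin_cases i <;> fin_cases j <;> simp_all
  obtain ⟨σ, hσ⟩ := exists_alternating_map ⟨_, inj h⟩ ⟨_, inj h'⟩ hα
  exact ⟨σ, hσ 0, hσ 1⟩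

theorem exists_alternating_map_four (hα : 6 ≤ Fintype.card α) {a b a' b' c d : α}
    (hab : a ≠ b) (hab' : a' ≠ b') (hcd : c ≠ d) (hc : a ≠ c ∧ b ≠ c ∧ a' ≠ c ∧ b' ≠ c)
    (hd : a ≠ d ∧ b ≠ d ∧ a' ≠ d ∧ b' ≠ d) :
    ∃ σ : alternatingGroup α, σ.1 a = a' ∧ σ.1 b = b' ∧ σ.1 c = c ∧ σ.1 d = d := by
  have inj : ∀ {a b : α}, a ≠ b → a ≠ c → b ≠ c → a ≠ d → b ≠ d →
      Function.Injective ![a, b, c, d] := by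
    intro a b h1 h2 h3 h4 h5 i j hij
    fin_cases i <;> fin_cases j <;> simp_all
  obtain ⟨σ, hσ⟩ := exists_alternating_map ⟨_, inj hab hc.1 hc.2.1 hd.1 hd.2.1⟩
    ⟨_, inj hab' hc.2.2.1 hc.2.2.2 hd.2.2.1 hd.2.2.2⟩ hα
  exact ⟨σ, hσ 0, hσ 1, hσ 2, hσ 3⟩

theorem exists_isThreeCycle {a b c : α} (hab : a ≠ b) (hac : a ≠ c) (hbc : b ≠ c) :
    ∃ σ : alternatingGroup α, σ.1.IsThreeCycle ∧ σ.1 a = b ∧ σ.1 b = c ∧ σ.1 c = a ∧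
      ∀ s, s ≠ a → s ≠ b → s ≠ c → σ.1 s = s := by
  have h := isThreeCycle_swap_mul_swap_same hab.symm hbc hac
  refine ⟨⟨_, h.mem_alternatingGroup⟩, h, ?_, ?_, ?_, fun s ha hb hc ↦ ?_⟩
  · simp [swap_apply_of_ne_of_ne hab hac]
  · simp [swap_apply_of_ne_of_ne hbc.symm hac.symm]
  · simp
  · simp [swap_apply_of_ne_of_ne, ha, hb, hc]

theorem exists_ofSubtype_eq {A : Finset α} {g : alternatingGroup α}
    (hg : ∀ x ∉ A, g.1 x = x) : ∃ g' : alternatingGroup A, alternatingGroup.ofSubtype A g' = g := by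
  have hA : ∀ x, g.1 x ≠ x → x ∈ A := fun x hx ↦ by_contra fun h ↦ hx (hg x h)
  have hm : ∀ x, g.1 x ∈ A ↔ x ∈ A := fun x ↦ by
    by_cases hx : g.1 x = x
    · rw [hx]
    · exact iff_of_true (hA _ fun h ↦ hx (g.1.injective h)) (hA _ hx)
  refine ⟨⟨g.1.subtypePerm hm, ?_⟩, Subtype.ext (ofSubtype_subtypePerm hm hA)⟩
  rw [mem_alternatingGroup, ← sign_ofSubtype, ofSubtype_subtypePerm hm hA]
  exact g.2

theorem closure_isThreeCycle_eq_top :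
    Subgroup.closure {g : alternatingGroup α | g.1.IsThreeCycle} = ⊤ := by
  rw [← closure_three_cycles_eq_alternating]
  exact Subgroup.closure_closure_coe_preimage

theorem mem_of_forall_isThreeCycle {H : Subgroup (alternatingGroup α)} {S : Finset α}
    (hH : ∀ z : alternatingGroup α, z.1.IsThreeCycle → (∀ s ∈ S, z.1 s = s) → z ∈ H)
    {g : alternatingGroup α} (hg : ∀ s ∈ S, g.1 s = s) : g ∈ H := by
  obtain ⟨g', rfl⟩ := exists_ofSubtype_eq (A := Sᶜ) (g := g) (by simpa using hg)
  have key : (⊤ : Subgroup (alternatingGroup ↥Sᶜ)) ≤ H.comap (alternatingGroup.ofSubtype Sᶜ) := by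
    rw [← closure_isThreeCycle_eq_top, Subgroup.closure_le]
    intro b hb
    refine hH _ ?_ fun s hs ↦ ?_
    · rw [IsThreeCycle, alternatingGroup.coe_ofSubtype, cycleType_ofSubtype]
      exact hb
    · exact ofSubtype_apply_of_not_mem b.1 (by simpa using hs)
  exact key (Subgroup.mem_top g')

theorem exists_notMem_of_card_lt {S : Finset α} (h : S.card < Fintype.card α) : ∃ x, x ∉ S := by
  by_contra! hS
  exact h.ne (Finset.card_eq_iff_eq_univ S |>.2 (Finset.eq_univ_of_forall hS))

theorem mem_of_forall_fixing {H : Subgroup (alternatingGroup α)} {S : Finset α} {p q : α}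
    (hpq : p ≠ q) (hp : p ∉ S) (hS : S.card + 6 ≤ Fintype.card α)
    (Hp : ∀ g : alternatingGroup α, (∀ s ∈ insert p S, g.1 s = s) → g ∈ H)
    (Hq : ∀ g : alternatingGroup α, (∀ s ∈ insert q S, g.1 s = s) → g ∈ H)
    {g : alternatingGroup α} (hg : ∀ s ∈ S, g.1 s = s) : g ∈ H := by
  refine mem_of_forall_isThreeCycle (fun z hz hzS ↦ ?_) hg
  obtain ⟨t, ht⟩ := exists_notMem_of_card_lt (S := (insert p (insert q S)) ∪ z.1.support) <| by
    have h1 := Finset.card_union_le (insert p (insert q S)) z.1.support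
    have h2 := Finset.card_insert_le p (insert q S)
    have h3 := Finset.card_insert_le q S
    have h4 := hz.card_support
    omega
  obtain ⟨p', hp'⟩ := exists_notMem_of_card_lt (S := insert t (insert p (insert q S))) <| by
    have h1 := Finset.card_insert_le t (insert p (insert q S))
    have h2 := Finset.card_insert_le p (insert q S)
    have h3 := Finset.card_insert_le q S
    omega
  simp only [Finset.mem_union, Finset.mem_insert, not_or, mem_support, not_not] at ht hp'
  obtain ⟨h, -, h1, -, -, h2⟩ := exists_isThreeCycle (a := t) (b := p) (c := p') ht.1.1
    (Ne.symm hp'.1) (Ne.symm hp'.2.1)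
  have hS : ∀ s ∈ S, h.1 s = s := fun s hs ↦ h2 s (by rintro rfl; exact ht.1.2.2 hs)
    (by rintro rfl; exact hp hs) (by rintro rfl; exact hp'.2.2.2 hs)
  have hq : h ∈ H := Hq h fun s hs ↦ by
    obtain rfl | hs := Finset.mem_insert.1 hs
    · exact h2 s (Ne.symm ht.1.2.1) hpq.symm (Ne.symm hp'.2.2.1)
    · exact hS s hs
  have hz' : h * z * h⁻¹ ∈ H := Hp _ fun s hs ↦ by
    obtain rfl | hs := Finset.mem_insert.1 hs
    · have : (h⁻¹).1 s = t := (inv_eq_iff_eq (f := h.1)).2 h1.symm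
      change h.1 (z.1 ((h⁻¹).1 s)) = s
      rw [this, ht.2, h1]
    · have : (h⁻¹).1 s = s := (inv_eq_iff_eq (f := h.1)).2 (hS s hs).symm
      change h.1 (z.1 ((h⁻¹).1 s)) = s
      rw [this, hzS s hs, hS s hs]
  simpa [mul_assoc] using H.mul_mem (H.mul_mem (H.inv_mem hq) hz') hq

end Permutations

section DifferenceFamily

variable {k : Type*} [Field k] {V : Type*} [AddCommGroup V] [Module k V]

theorem apply_eq_apply_of_inv_mul {G : Type*} [Group G] {ρ : Representation k G V} {g g' : G}
    {v : V} (h : ρ (g'⁻¹ * g) v = v) : ρ g v = ρ g' v := by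
  rw [map_mul, Module.End.mul_apply] at h
  rw [← h, ρ.self_inv_apply, h]

/-- The subgroup fixing a vector of a representation. -/
def fixer {G : Type*} [Group G] (ρ : Representation k G V) (v : V) : Subgroup G where
  carrier := {g | ρ g v = v}
  one_mem' := by simp
  mul_mem' {a b} ha hb := by
    simp only [Set.mem_ofPred_eq] at ha hb ⊢
    rw [map_mul, Module.End.mul_apply, hb, ha]
  inv_mem' {a} ha := by
    simp only [Set.mem_ofPred_eq] at ha ⊢
    conv_lhs => rw [← ha]
    exact ρ.inv_self_apply a v

variable {α : Type*} [Fintype α] [DecidableEq α]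

/-- An equivariant family of vectors which behave like the differences `e i - e j` of the
standard basis vectors of the permutation module. -/
structure IsDifferenceFamily (ρ : Representation k (alternatingGroup α) V) (W : α → α → V) :
    Prop where
  map (g : alternatingGroup α) (i j : α) : ρ g (W i j) = W (g.1 i) (g.1 j)
  add (i j l : α) : W i j + W j l = W i l

variable {ρ : Representation k (alternatingGroup α) V}

theorem inv_mul_apply_eq {g g' : alternatingGroup α} {a : α} (h : g.1 a = g'.1 a) :
    (g'⁻¹ * g).1 a = a := by
  exact (Equiv.Perm.inv_eq_iff_eq (f := g'.1)).2 h

theorem exists_isDifferenceFamily_of_fixed (hα : 8 ≤ Fintype.card α) {p q r : α}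
    (hpq : p ≠ q) (hpr : p ≠ r) (hqr : q ≠ r) {u : V}
    (hu : ∀ g : alternatingGroup α, g.1 p = p → g.1 q = q → g.1 r = r → ρ g u = u)
    {z : alternatingGroup α} (zp : z.1 p ≠ p) (zq : z.1 q = q) (zr : z.1 r = r)
    (hw : ∀ g : alternatingGroup α, g.1 p = p → g.1 (z.1 p) = z.1 p →
      ρ g (ρ z u - u) = ρ z u - u) :
    ∃ W, IsDifferenceFamily ρ W ∧ W (z.1 p) p = ρ z u - u := by
  classical
  have ziq : z.1 p ≠ q := fun h ↦ hpq (z.1.injective (h.trans zq.symm))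
  have zir : z.1 p ≠ r := fun h ↦ hpr (z.1.injective (h.trans zr.symm))
  have hγ : ∀ i j : α, ∃ g : alternatingGroup α, i ≠ j → g.1 (z.1 p) = i ∧ g.1 p = j := by
    intro i j
    by_cases hij : i = j
    · exact ⟨1, fun h ↦ absurd hij h⟩
    · obtain ⟨g, hg⟩ := exists_alternating_map_two (by omega) zp hij
      exact ⟨g, fun _ ↦ hg⟩
  choose γ hγ using hγ
  obtain ⟨W, hW0, hW⟩ : ∃ W : α → α → V, (∀ i, W i i = 0) ∧
      ∀ g : alternatingGroup α, ρ g (ρ z u - u) = W (g.1 (z.1 p)) (g.1 p) := by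
    refine ⟨fun i j ↦ if i = j then 0 else ρ (γ i j) (ρ z u - u), fun i ↦ if_pos rfl, fun g ↦ ?_⟩
    have hne : g.1 (z.1 p) ≠ g.1 p := g.1.injective.ne zp
    refine Eq.trans ?_ (if_neg hne).symm
    exact apply_eq_apply_of_inv_mul (hw _ (inv_mul_apply_eq (hγ _ _ hne).2.symm)
      (inv_mul_apply_eq (hγ _ _ hne).1.symm))
  have hmap : ∀ (g : alternatingGroup α) i j, ρ g (W i j) = W (g.1 i) (g.1 j) := by
    intro g i j
    by_cases hij : i = j
    · rw [hij, hW0, hW0, map_zero]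
    · obtain ⟨h1, h2⟩ := hγ i j hij
      have h := hW (γ i j)
      rw [h1, h2] at h
      rw [← h, ← Module.End.mul_apply, ← map_mul, hW]
      change W (g.1 ((γ i j).1 _)) (g.1 ((γ i j).1 _)) = _
      rw [h1, h2]
  obtain ⟨P, hP⟩ : ∃ P : α → V, ∀ g : alternatingGroup α, g.1 q = q → g.1 r = r →
      ρ g u = P (g.1 p) := by
    refine ⟨fun a ↦ if h : ∃ g : alternatingGroup α, g.1 p = a ∧ g.1 q = q ∧ g.1 r = r
      then ρ h.choose u else 0, fun g hq hr ↦ ?_⟩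
    have h : ∃ g' : alternatingGroup α, g'.1 p = g.1 p ∧ g'.1 q = q ∧ g'.1 r = r :=
      ⟨g, rfl, hq, hr⟩
    obtain ⟨h1, h2, h3⟩ := h.choose_spec
    refine Eq.trans ?_ (dif_pos h).symm
    exact apply_eq_apply_of_inv_mul (hu _ (inv_mul_apply_eq h1.symm)
      (inv_mul_apply_eq (hq.trans h2.symm)) (inv_mul_apply_eq (hr.trans h3.symm)))
  have hdiff : ∀ i j, i ≠ q → i ≠ r → j ≠ q → j ≠ r → W i j = P i - P j := by
    intro i j hiq hir hjq hjr
    by_cases hij : i = j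
    · rw [hij, hW0, sub_self]
    · obtain ⟨g, g1, g2, g3, g4⟩ := exists_alternating_map_four (by omega) zp hij hqr
        ⟨ziq, hpq, hiq, hjq⟩ ⟨zir, hpr, hir, hjr⟩
      have h := hW g
      rw [g1, g2] at h
      rw [← h, map_sub, ← Module.End.mul_apply, ← map_mul, hP g g3 g4, g2,
        hP (g * z) ((congrArg g.1 zq).trans g3) ((congrArg g.1 zr).trans g4)]
      change P (g.1 (z.1 p)) - _ = _
      rw [g1]
  refine ⟨W, ⟨hmap, fun i j l ↦ ?_⟩, ?_⟩
  · obtain ⟨a, ha⟩ := exists_notMem_of_card_lt (S := {i, j, l})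
      (Finset.card_le_three.trans_lt (by omega))
    obtain ⟨b, hb⟩ := exists_notMem_of_card_lt (S := {i, j, l, a})
      (Finset.card_le_four.trans_lt (by omega))
    simp only [Finset.mem_insert, Finset.mem_singleton, not_or] at ha hb
    obtain ⟨g, rfl, rfl⟩ := exists_alternating_map_two (by omega) (Ne.symm hb.2.2.2) hqr
    have hne : ∀ x y, ¬ y = x → g.1 x ≠ g.1 y := fun x y h ↦ g.1.injective.ne (Ne.symm h)
    have hi := hne i _ ha.1
    have hj := hne j _ ha.2.1
    have hl := hne l _ ha.2.2
    have hi' := hne i _ hb.1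
    have hj' := hne j _ hb.2.1
    have hl' := hne l _ hb.2.2.1
    refine (ρ.apply_bijective g).1 ?_
    rw [map_add, hmap, hmap, hmap, hdiff _ _ hi hi' hj hj', hdiff _ _ hj hj' hl hl',
      hdiff _ _ hi hi' hl hl', sub_add_sub_cancel]
  · simpa using (hW 1).symm

/-- A nontrivial representation in which disjoint `3`-cycles `x`, `y` satisfy
`(x - 1) (y - 1) = 0` has a nonzero difference family. -/
theorem exists_isDifferenceFamily (hα : 8 ≤ Fintype.card α)
    (hdis : ∀ x y : alternatingGroup α, x.1.IsThreeCycle → y.1.IsThreeCycle →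
      Equiv.Perm.Disjoint x.1 y.1 → ∀ v, ρ x (ρ y v - v) = ρ y v - v)
    (hρ : ∃ g, ρ g ≠ 1) : ∃ W, IsDifferenceFamily ρ W ∧ ∃ i j, W i j ≠ 0 := by
  by_contra! hW
  have hfix : ∀ y : alternatingGroup α, y.1.IsThreeCycle → ∀ v, ∀ p q r : α,
      p ≠ q → p ≠ r → q ≠ r → y.1.support = {p, q, r} →
      ∀ g : alternatingGroup α, g.1 p = p → g.1 q = q → g.1 r = r →
        ρ g (ρ y v - v) = ρ y v - v := by
    intro y hy v p q r hpq hpr hqr hs g gp gq gr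
    refine mem_of_forall_isThreeCycle (H := fixer ρ (ρ y v - v)) (S := y.1.support)
      (fun z hz hzy ↦ hdis z y hz hy (fun a ↦ ?_) v) ?_
    · by_cases ha : a ∈ y.1.support
      · exact .inl (hzy a ha)
      · exact .inr (by simpa using ha)
    · simp [hs, gp, gq, gr]
  have hone : ∀ y : alternatingGroup α, y.1.IsThreeCycle → ∀ v, ∀ p q r : α,
      p ≠ q → p ≠ r → q ≠ r → y.1.support = {p, q, r} →
      ∀ g : alternatingGroup α, (∀ s ∈ ({q, r} : Finset α), g.1 s = s) →
        g ∈ fixer ρ (ρ y v - v) := by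
    intro y hy v p q r hpq hpr hqr hs g hg
    refine mem_of_forall_isThreeCycle (fun z hz hzS ↦ ?_) hg
    have hu := hfix y hy v p q r hpq hpr hqr hs
    set u := ρ y v - v
    have zq : z.1 q = q := hzS q (by simp)
    have zr : z.1 r = r := hzS r (by simp)
    by_cases zp : z.1 p = p
    · exact hu z zp zq zr
    obtain ⟨W, hW', hWz⟩ := exists_isDifferenceFamily_of_fixed hα hpq hpr hqr hu zp zq zr <| by
      intro g gp gi
      refine mem_of_forall_isThreeCycle (H := fixer ρ (ρ z u - u)) (S := {p, z.1 p})
        (fun h hh hhS ↦ ?_) (by simp [gp, gi])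
      obtain ⟨t, ht⟩ := exists_notMem_of_card_lt (S := {p, q, r, z.1 p} ∪ h.1.support) <| by
        have h1 := Finset.card_union_le {p, q, r, z.1 p} h.1.support
        have h2 := Finset.card_le_four (a := p) (b := q) (c := r) (d := z.1 p)
        have h3 := hh.card_support
        omega
      simp only [Finset.mem_union, Finset.mem_insert, Finset.mem_singleton, not_or,
        Equiv.Perm.mem_support, not_not] at ht
      obtain ⟨⟨tp, tq, tr, ti⟩, ht⟩ := ht
      obtain ⟨x, hx, x1, x2, x3, x4⟩ := exists_isThreeCycle (Ne.symm zp) (Ne.symm tp) (Ne.symm ti)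
      have ziq : z.1 p ≠ q := fun h ↦ hpq (z.1.injective (h.trans zq.symm))
      have zir : z.1 p ≠ r := fun h ↦ hpr (z.1.injective (h.trans zr.symm))
      have xq := x4 q hpq.symm ziq.symm (Ne.symm tq)
      have xr := x4 r hpr.symm zir.symm (Ne.symm tr)
      have hzx : ρ z u = ρ x u := apply_eq_apply_of_inv_mul <| hu _ (inv_mul_apply_eq x1.symm)
        (inv_mul_apply_eq (zq.trans xq.symm)) (inv_mul_apply_eq (zr.trans xr.symm))
      change ρ h _ = _
      rw [hzx]
      refine hdis h x hh hx (fun a ↦ ?_) u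
      by_cases hap : a = p
      · exact .inl (hap ▸ hhS p (by simp))
      by_cases hai : a = z.1 p
      · exact .inl (hai ▸ hhS _ (by simp))
      by_cases hat : a = t
      · exact .inl (hat ▸ ht)
      · exact .inr (x4 a hap hai hat)
    exact sub_eq_zero.1 (hWz.symm.trans (hW W hW' _ _))
  have hall : ∀ y : alternatingGroup α, y.1.IsThreeCycle → ∀ v g, g ∈ fixer ρ (ρ y v - v) := by
    intro y hy v g
    obtain ⟨p, q, r, hpq, hpr, hqr, hs⟩ := Finset.card_eq_three.1 hy.card_support
    have hr := hone y hy v p q r hpq hpr hqr hs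
    have hq := hone y hy v q p r hpq.symm hqr hpr (by rw [hs]; ext; simp; tauto)
    have hp := hone y hy v r p q hpr.symm hqr.symm hpq (by rw [hs]; ext; simp; tauto)
    have h1 : ∀ g : alternatingGroup α, (∀ s ∈ ({r} : Finset α), g.1 s = s) →
        g ∈ fixer ρ (ρ y v - v) := fun g hg ↦
      mem_of_forall_fixing hpq (by simpa using hpr) (by simp; omega) hq hr hg
    have h2 : ∀ g : alternatingGroup α, (∀ s ∈ ({p} : Finset α), g.1 s = s) →
        g ∈ fixer ρ (ρ y v - v) := fun g hg ↦
      mem_of_forall_fixing hqr (by simpa using hpq.symm) (by simp; omega)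
        (fun g hg ↦ hp g (by simpa [and_comm] using hg))
        (fun g hg ↦ hq g (by simpa [and_comm] using hg)) hg
    exact mem_of_forall_fixing (S := ∅) hpr (by simp) (by simp; omega) h2 h1 (by simp)
  obtain ⟨g, hg⟩ := hρ
  refine hg (LinearMap.ext fun v ↦ ?_)
  refine apply_eq_self_of_perfect
    (commutator_alternatingGroup_eq_top (by simp; omega)) ρ v (fun g g' ↦ ?_) g
  let K : Subgroup (alternatingGroup α) :=
    { carrier := {g' | ∀ v g, ρ g (ρ g' v - v) = ρ g' v - v}
      one_mem' := by simp
      mul_mem' := fun {a b} ha hb v g ↦ by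
        have : ρ (a * b) v - v = (ρ a (ρ b v) - ρ b v) + (ρ b v - v) := by
          rw [map_mul, Module.End.mul_apply, sub_add_sub_cancel]
        rw [this, map_add, ha, hb]
      inv_mem' := fun {a} ha v g ↦ by
        have : ρ a⁻¹ v - v = - (ρ a (ρ a⁻¹ v) - ρ a⁻¹ v) := by
          rw [ρ.self_inv_apply, neg_sub]
        rw [this, map_neg, ha] }
  exact mem_of_forall_isThreeCycle (H := K) (S := ∅) (fun y hy _ v g ↦ hall y hy v g)
    (by simp) v g

namespace IsDifferenceFamily

variable {W : α → α → V} (hW : IsDifferenceFamily ρ W)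
include hW

theorem self (i : α) : W i i = 0 := by simpa using hW.add i i i

theorem ne_zero (hα : 4 ≤ Fintype.card α) {i j : α} (h : W i j ≠ 0) {a b : α} (hab : a ≠ b) :
    W a b ≠ 0 := by
  have hij : i ≠ j := by
    rintro rfl
    exact h (hW.self i)
  obtain ⟨g, rfl, rfl⟩ := exists_alternating_map_two hα hij hab
  rw [← hW.map]
  exact fun h0 ↦ h ((ρ.apply_bijective g).1 (h0.trans (map_zero _).symm))

theorem card_sub_two_le_finrank [FiniteDimensional k V] (hα : 8 ≤ Fintype.card α) {i j : α}
    (h : W i j ≠ 0) : Fintype.card α - 2 ≤ finrank k V := by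
  have : 1 < Fintype.card α := by omega
  obtain ⟨o, l, hol⟩ := Fintype.exists_ne_of_one_lt_card this i |>.imp fun o _ ↦
    Fintype.exists_ne_of_one_lt_card this o |>.imp fun _ ↦ Ne.symm
  have hcard : Fintype.card {a // a ∉ ({o, l} : Finset α)} = Fintype.card α - 2 := by
    rw [Fintype.card_subtype_compl, Fintype.card_coe, Finset.card_pair hol]
  rw [← hcard]
  refine LinearIndependent.fintype_card_le_finrank (R := k)
    (b := fun a : {a // a ∉ ({o, l} : Finset α)} ↦ W a o) ?_
  rw [Fintype.linearIndependent_iff]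
  rintro c hc ⟨a, ha⟩
  simp only [Finset.mem_insert, Finset.mem_singleton, not_or] at ha
  obtain ⟨s, hs⟩ := exists_notMem_of_card_lt (S := {o, l, a})
    (Finset.card_le_three.trans_lt (by omega))
  obtain ⟨t, ht⟩ := exists_notMem_of_card_lt (S := {o, l, a, s})
    (Finset.card_le_four.trans_lt (by omega))
  obtain ⟨t', ht'⟩ := exists_notMem_of_card_lt (S := {o, l, a, s, t})
    (Finset.card_le_five.trans_lt (by omega))
  simp only [Finset.mem_insert, Finset.mem_singleton, not_or] at hs ht ht'
  obtain ⟨g, -, g1, g2, g3, g4⟩ := exists_isThreeCycle ha.2 (Ne.symm hs.2.2) (Ne.symm hs.2.1)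
  obtain ⟨f, -, f1, f2, f3, f4⟩ := exists_isThreeCycle (Ne.symm ht.2.1) (Ne.symm ht'.2.1)
    (Ne.symm ht'.2.2.2.2)
  have key : ∀ σ : alternatingGroup α, σ.1 o = o → ∑ j, c j • W (σ.1 j) o = 0 := by
    intro σ hσ
    simpa [hW.map, hσ] using congrArg (ρ σ) hc
  have go : g.1 o = o := g4 o (Ne.symm ha.1) hol (Ne.symm hs.1)
  have fo : f.1 o = o := f4 o hol (Ne.symm ht.1) (Ne.symm ht'.1)
  have fa : f.1 a = a := f4 a ha.2 (Ne.symm ht.2.2.1) (Ne.symm ht'.2.2.1)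
  have fs : f.1 s = s := f4 s hs.2.1 (Ne.symm ht.2.2.2) (Ne.symm ht'.2.2.2.1)
  have hsum : ∑ j, c j • (W (f.1 (g.1 j)) o - W (f.1 j) o - W (g.1 j) o + W j o) = 0 := by
    have h1 := key 1 rfl
    have h2 := key (f * g) ((congrArg f.1 go).trans fo)
    simp only [OneMemClass.coe_one, Equiv.Perm.one_apply, Subgroup.coe_mul,
      Equiv.Perm.mul_apply] at h1 h2
    simp [smul_sub, smul_add, Finset.sum_add_distrib, Finset.sum_sub_distrib, key f fo, key g go,
      h1, h2]
  rw [Finset.sum_eq_single ⟨a, by simpa using ha⟩ (fun j _ hj ↦ ?_) (by simp)] at hsum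
  · rw [g1, f1, fa, sub_right_comm, sub_add_cancel, sub_eq_iff_eq_add.2 (hW.add t l o).symm] at hsum
    exact (smul_eq_zero.1 hsum).resolve_right (hW.ne_zero (by omega) h ht.2.1)
  · by_cases hjs : j.1 = s
    · simp [hjs, g3, fa, fs]
    · have hja : j.1 ≠ a := fun h ↦ hj (Subtype.ext h)
      have hjl : j.1 ≠ l := fun h ↦ j.2 (by simp [h])
      simp [g4 j.1 hja hjl hjs]

theorem finrank_le [FiniteDimensional k V] (hirr : ρ.IsIrred) {i j : α} (h : W i j ≠ 0) :
    finrank k V ≤ Fintype.card α - 1 := by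
  have hspan : Submodule.span k (Set.range fun a : {a // a ≠ j} ↦ W a j) = ⊤ := by
    have hmem : ∀ a, W a j ∈ Submodule.span k (Set.range fun a : {a // a ≠ j} ↦ W a j) := by
      intro a
      by_cases ha : a = j
      · rw [ha, hW.self]
        exact zero_mem _
      · exact Submodule.subset_span ⟨⟨a, ha⟩, rfl⟩
    refine (hirr _ fun g v hv ↦ ?_).resolve_left fun h0 ↦
      h ((Submodule.eq_bot_iff _).1 h0 _ (hmem i))
    induction hv using Submodule.span_induction with
    | mem x hx =>
      obtain ⟨a, rfl⟩ := hx
      have := hW.add (g.1 a) (g.1 j) j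
      rw [hW.map, eq_sub_iff_add_eq.2 this]
      exact sub_mem (hmem _) (hmem _)
    | zero => simp
    | add x y _ _ hx hy => rw [map_add]; exact add_mem hx hy
    | smul c x _ hx => rw [map_smul]; exact Submodule.smul_mem _ _ hx
  have := finrank_range_le_card (R := k) (fun a : {a // a ≠ j} ↦ W a j)
  rw [Set.finrank, hspan, finrank_top] at this
  simpa using this

end IsDifferenceFamily

end DifferenceFamily

section AlternatingDegrees

/-- Every nontrivial representation over `k` of an alternating group on `d` letters has dimension
at least `m`. -/
def AltMinDegree (k : Type u) [Field k] (d m : ℕ) : Prop :=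
  ∀ (β : Type) [Fintype β] [DecidableEq β], Fintype.card β = d → MinDegree k (alternatingGroup β) m

variable {k : Type u} [Field k]

theorem commutator_alternatingGroup_of_card {β : Type*} [Fintype β] [DecidableEq β]
    (h : 5 ≤ Fintype.card β) : commutator (alternatingGroup β) = ⊤ :=
  commutator_alternatingGroup_eq_top (by rwa [Nat.card_eq_fintype_card])

theorem altMinDegree_two {d : ℕ} (hd : 5 ≤ d) : AltMinDegree k d 2 := by
  intro β _ _ hβ V _ _ _ ρ ⟨g, hg⟩
  by_contra! hV
  obtain ⟨v, hv⟩ := finrank_le_one_iff.1 (Nat.le_of_lt_succ hV)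
  have hcomm : ∀ S T : Module.End k V, S * T = T * S := by
    intro S T
    ext w
    obtain ⟨c, rfl⟩ := hv w
    obtain ⟨s, hs⟩ := hv (S v)
    obtain ⟨t, ht⟩ := hv (T v)
    simp only [Module.End.mul_apply, map_smul, ← hs, ← ht]
    rw [smul_comm s t]
  have hker : commutator (alternatingGroup β) ≤ MonoidHom.ker ρ := by
    rw [commutator_def, Subgroup.commutator_le]
    intro a _ b _
    rw [MonoidHom.mem_ker, commutatorElement_def, map_mul, map_mul, map_mul, hcomm (ρ a) (ρ b),
      ← map_mul, ← map_mul, ← map_mul]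
    simp
  rw [commutator_alternatingGroup_of_card (hβ ▸ hd)] at hker
  exact hg (hker (Subgroup.mem_top g))

theorem exists_ne_one_of_isIrred {G V : Type*} [Group G] [AddCommGroup V] [Module k V]
    {ρ : Representation k G V} (hρ : ρ.IsIrred) (hV : 1 < finrank k V) : ∃ g, ρ g ≠ 1 := by
  by_contra! h
  have : Nontrivial V := Module.nontrivial_of_finrank_pos (R := k) (by omega)
  obtain ⟨v, hv⟩ := exists_ne (0 : V)
  obtain h0 | h1 := hρ (Submodule.span k {v}) fun g w hw ↦ by simpa [h g] using hw
  · exact hv (Submodule.span_singleton_eq_bot.1 h0)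
  · have := finrank_span_singleton (K := k) hv
    rw [h1, finrank_top] at this
    omega

variable [IsAlgClosed k] {α : Type} [Fintype α] [DecidableEq α] {V : Type u} [AddCommGroup V]
  [Module k V] [FiniteDimensional k V] {ρ : Representation k (alternatingGroup α) V}

theorem apply_sub_eq_of_disjoint {a b m₁ m₂ : ℕ} (ha : 5 ≤ a) (hb : 5 ≤ b)
    (hα : Fintype.card α = a + b) (h₁ : AltMinDegree k a m₁) (h₂ : AltMinDegree k b m₂)
    (hV : finrank k V < m₁ * m₂) {x y : alternatingGroup α} (hx : x.1.IsThreeCycle)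
    (hy : y.1.IsThreeCycle) (hxy : Equiv.Perm.Disjoint x.1 y.1) (v : V) :
    ρ x (ρ y v - v) = ρ y v - v := by
  have hsub : x.1.support ⊆ y.1.supportᶜ := by
    rw [Finset.subset_compl_iff_disjoint_right]
    exact hxy.disjoint_support
  obtain ⟨A, hxA, hAy, hA⟩ := Finset.exists_subsuperset_card_eq (n := a) hsub
    (by rw [hx.card_support]; omega) (by rw [Finset.card_compl, hy.card_support]; omega)
  obtain ⟨x, rfl⟩ := exists_ofSubtype_eq (A := A) (g := x) fun i hi ↦ by
    simpa using fun h ↦ hi (hxA h)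
  obtain ⟨y, rfl⟩ := exists_ofSubtype_eq (A := Aᶜ) (g := y) fun i hi ↦ by
    simpa using hAy (by simpa using hi)
  have hA' : Fintype.card A = a := by rw [Fintype.card_coe, hA]
  have hB' : Fintype.card ↥Aᶜ = b := by rw [Fintype.card_coe, Finset.card_compl]; omega
  refine apply_sub_eq_of_finrank_lt (h₁ A hA') (h₂ ↥Aᶜ hB')
    (commutator_alternatingGroup_of_card (hA' ▸ ha))
    (commutator_alternatingGroup_of_card (hB' ▸ hb))
    (ρ.comp (alternatingGroup.ofSubtype A)) (ρ.comp (alternatingGroup.ofSubtype Aᶜ))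
    (fun g h v ↦ ?_) hV x y v
  have hcomm : Commute (alternatingGroup.ofSubtype A g) (alternatingGroup.ofSubtype Aᶜ h) := by
    refine Subtype.ext (Equiv.Perm.Disjoint.commute fun i ↦ ?_)
    by_cases hi : i ∈ A
    · exact .inr (Equiv.Perm.ofSubtype_apply_of_not_mem h.1 (by simpa using hi))
    · exact .inl (Equiv.Perm.ofSubtype_apply_of_not_mem g.1 hi)
  simp only [MonoidHom.comp_apply, ← Module.End.mul_apply, ← map_mul, hcomm.eq]

theorem exists_isDifferenceFamily_of_finrank_lt {a b m₁ m₂ : ℕ} (ha : 5 ≤ a) (hb : 5 ≤ b)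
    (hα : Fintype.card α = a + b) (h₁ : AltMinDegree k a m₁) (h₂ : AltMinDegree k b m₂)
    (hV : finrank k V < m₁ * m₂) (hρ : ∃ g, ρ g ≠ 1) :
    ∃ W, IsDifferenceFamily ρ W ∧ ∃ i j, W i j ≠ 0 :=
  exists_isDifferenceFamily (by omega)
    (fun _ _ hx hy hxy v ↦ apply_sub_eq_of_disjoint ha hb hα h₁ h₂ hV hx hy hxy v) hρ

theorem AltMinDegree.add {a b m₁ m₂ m : ℕ} (ha : 5 ≤ a) (hb : 5 ≤ b) (h₁ : AltMinDegree k a m₁)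
    (h₂ : AltMinDegree k b m₂) (hm : m ≤ m₁ * m₂) (hm' : m ≤ a + b - 2) :
    AltMinDegree k (a + b) m := by
  intro β _ _ hβ V _ _ _ ρ hρ
  by_contra! hV
  obtain ⟨W, hW, i, j, hij⟩ :=
    exists_isDifferenceFamily_of_finrank_lt ha hb hβ h₁ h₂ (hV.trans_le hm) hρ
  have := hW.card_sub_two_le_finrank (by omega) hij
  omega

theorem AltMinDegree.add_five {a m : ℕ} (ha : 5 ≤ a) (h : AltMinDegree k a m)
    (hm : 2 * m ≤ a + 3) : AltMinDegree k (a + 5) (2 * m) :=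
  .add ha le_rfl h (altMinDegree_two le_rfl) (by omega) (by omega)

theorem altMinDegree_four {d : ℕ} (hd : 10 ≤ d) : AltMinDegree k d 4 := by
  obtain ⟨a, rfl⟩ := Nat.exists_eq_add_of_le' (show 5 ≤ d by omega)
  exact (altMinDegree_two (by omega)).add_five (by omega) (by omega)

theorem altMinDegree_eight {d : ℕ} (hd : 15 ≤ d) : AltMinDegree k d 8 := by
  obtain ⟨a, rfl⟩ := Nat.exists_eq_add_of_le' (show 5 ≤ d by omega)
  exact (altMinDegree_four (by omega)).add_five (by omega) (by omega)

theorem altMinDegree_sixteen {d : ℕ} (hd : 20 ≤ d) : AltMinDegree k d 16 := by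
  obtain ⟨a, rfl⟩ := Nat.exists_eq_add_of_le' (show 5 ≤ d by omega)
  exact (altMinDegree_eight (by omega)).add_five (by omega) (by omega)

theorem altMinDegree_sub_two {d : ℕ} (hd : 25 ≤ d) : AltMinDegree k d (d - 2) := by
  induction d using Nat.strong_induction_on with
  | _ d ih =>
    obtain ⟨a, rfl⟩ := Nat.exists_eq_add_of_le' (show 5 ≤ d by omega)
    obtain ha | ha := lt_or_ge a 25
    · exact .add (by omega) le_rfl (altMinDegree_sixteen (by omega)) (altMinDegree_two le_rfl)
        (by omega) le_rfl
    · exact .add (by omega) le_rfl (ih a (by omega) ha) (altMinDegree_two le_rfl)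
        (by omega) le_rfl

theorem exists_split {d n : ℕ} (hn : 250 < n) (hd : 2 * √(n : ℝ) + 15 < d) :
    ∃ a b m₁ m₂ : ℕ, d = a + b ∧ 5 ≤ a ∧ 5 ≤ b ∧ AltMinDegree k a m₁ ∧ AltMinDegree k b m₂ ∧
      n < m₁ * m₂ := by
  have hsqrt : 15.8 < √(n : ℝ) := by
    rw [Real.lt_sqrt (by norm_num)]
    have : (251 : ℝ) ≤ n := by exact_mod_cast hn
    linarith
  have hd' : 47 ≤ d := by
    have : (46 : ℝ) < d := by linarith
    exact_mod_cast this
  obtain ⟨e, rfl⟩ := Nat.exists_eq_add_of_le' hd'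
  have hlt : 4 * n < (e + 32) ^ 2 := by
    have h1 := Real.sq_sqrt (Nat.cast_nonneg (α := ℝ) n)
    push_cast at hd
    have : (4 * n : ℝ) < (e + 32) ^ 2 := by nlinarith
    exact_mod_cast this
  obtain he | he := lt_or_ge e 3
  · refine ⟨25, e + 22, 23, 16, by omega, by omega, by omega, altMinDegree_sub_two le_rfl,
      altMinDegree_sixteen (by omega), ?_⟩
    interval_cases e <;> omega
  · obtain ⟨c, rfl | rfl⟩ := Nat.even_or_odd' e
    · exact ⟨c + 23, c + 24, c + 21, c + 22, by omega, by omega, by omega,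
        altMinDegree_sub_two (d := c + 23) (by omega),
        altMinDegree_sub_two (d := c + 24) (by omega), by nlinarith⟩
    · exact ⟨c + 24, c + 24, c + 22, c + 22, by omega, by omega, by omega,
        altMinDegree_sub_two (d := c + 24) (by omega),
        altMinDegree_sub_two (d := c + 24) (by omega), by nlinarith⟩

theorem le_or_eq_of_isIrred {n d : ℕ} (hn : 250 < n)
    (ρ : Representation k (alternatingGroup (Fin d)) (Fin n → k)) (hρ : ρ.IsIrred) :
    (d : ℝ) ≤ 2 * √(n : ℝ) + 15 ∨ d = n + 1 ∨ d = n + 2 := by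
  refine or_iff_not_imp_left.2 fun hd ↦ ?_
  obtain ⟨a, b, m₁, m₂, hab, ha, hb, h₁, h₂, hlt⟩ := exists_split (k := k) hn (not_le.1 hd)
  obtain ⟨W, hW, i, j, hij⟩ := exists_isDifferenceFamily_of_finrank_lt ha hb
    (by rwa [Fintype.card_fin]) h₁ h₂ (by rwa [finrank_fin_fun])
    (exists_ne_one_of_isIrred hρ (by rw [finrank_fin_fun]; omega))
  have hge := hW.card_sub_two_le_finrank (by rw [Fintype.card_fin]; omega) hij
  have hle := hW.finrank_le hρ hij
  rw [Fintype.card_fin, finrank_fin_fun] at hge hle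
  omega

end AlternatingDegrees

end AltDegrees

theorem count_alternating_degrees (k : Type*) [Field k] [IsAlgClosed k]
    (n : ℕ) (hn : 250 < n) :
    (Nat.card {d : ℕ // 5 ≤ d ∧
        ∃ ρ : Representation k (alternatingGroup (Fin d)) (Fin n → k), ρ.IsIrred} : ℝ)
      < 2 * Real.sqrt n + 14 := by
  set N := ⌊2 * √(n : ℝ) + 15⌋₊
  have hpos : 0 ≤ √(n : ℝ) := Real.sqrt_nonneg _
  have hN : (N : ℝ) ≤ 2 * √(n : ℝ) + 15 := Nat.floor_le (by positivity)
  have hN4 : 4 ≤ N := Nat.le_floor (by push_cast; linarith)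
  have hsub : {d : ℕ | 5 ≤ d ∧
      ∃ ρ : Representation k (alternatingGroup (Fin d)) (Fin n → k), ρ.IsIrred} ⊆
      ↑(Finset.Icc 5 N ∪ {n + 1, n + 2}) := by
    rintro d ⟨hd, ρ, hρ⟩
    obtain h | h := AltDegrees.le_or_eq_of_isIrred hn ρ hρ
    · simp [hd, Nat.le_floor h, N]
    · simpa using h.elim .inl (.inr ∘ .inl)
  have hcard : Set.ncard {d : ℕ | 5 ≤ d ∧
      ∃ ρ : Representation k (alternatingGroup (Fin d)) (Fin n → k), ρ.IsIrred} + 2 ≤ N := by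
    have h1 := Set.ncard_le_ncard hsub (Finset.finite_toSet _)
    rw [Set.ncard_coe_finset] at h1
    have h2 := Finset.card_union_le (Finset.Icc 5 N) {n + 1, n + 2}
    have h3 := Finset.card_le_two (a := n + 1) (b := n + 2)
    rw [Nat.card_Icc] at h2
    omega
  have hcard' : (Set.ncard {d : ℕ | 5 ≤ d ∧
      ∃ ρ : Representation k (alternatingGroup (Fin d)) (Fin n → k), ρ.IsIrred} : ℝ) + 2 ≤ N := by
    exact_mod_cast hcard
  change (Set.ncard {d : ℕ | 5 ≤ d ∧
      ∃ ρ : Representation k (alternatingGroup (Fin d)) (Fin n → k), ρ.IsIrred} : ℝ) < _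
  linarith
end
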